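/- arXiv:0806.4669 — 3 statements merged into one kernel-verified Lean document; each statement's English description precedes it below -/
import Mathlib

section
/- If the matroid M_B is coloop free, then the coefficients of the Ehrhart δ-polynomial of the Lawrence polytope P_B satisfy δ_i ≤ δ_j for all i, j with i ≤ j ≤ d − i. -/
open scoped BigOperators Pointwise
open Polynomial

noncomputable section

namespace LawrencePaper

attribute [local instance] Classical.propDecidable

/-- The real vector associated to an integer vector. -/
def toR (d : ℕ) (v : Fin d → ℤ) : Fin d → ℝ := fun j => (v j : ℝ)

/-- The `i`-th standard basis vector of `ℝ^n`. -/
def e (n : ℕ) (i : Fin n) : Fin n → ℝ := Pi.single i 1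

/-- The Lawrence polytope of the configuration `b`: the convex hull of the points
`(b i, e i)` and `(0, e i)`. -/
def lawrencePolytope (d n : ℕ) (b : Fin n → Fin d → ℤ) : Set ((Fin d → ℝ) × (Fin n → ℝ)) :=
  convexHull ℝ
    ((Set.range fun i => (toR d (b i), e n i)) ∪
      (Set.range fun i => ((0 : Fin d → ℝ), e n i)))

/-- The number of lattice points in the `m`-th dilate of `P`. -/
def latticeCount (d n : ℕ) (P : Set ((Fin d → ℝ) × (Fin n → ℝ))) (m : ℕ) : ℕ :=
  Nat.card {z : (Fin d → ℤ) × (Fin n → ℤ) |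
    (toR d z.1, fun j => (z.2 j : ℝ)) ∈ (m : ℝ) • P}

/-- `δ` is the Ehrhart δ-polynomial of the `(d+n-1)`-dimensional polytope `P ⊆ ℝ^{d+n}`:
it has degree at most `n+d-1` and satisfies
`(1-t)^{n+d} * Σ_{m ≥ 0} f_P(m) t^m = δ(t)` as formal power series. -/
def IsDeltaPoly (d n : ℕ) (P : Set ((Fin d → ℝ) × (Fin n → ℝ))) (δ : Polynomial ℤ) : Prop :=
  δ.natDegree ≤ n + d - 1 ∧
    (1 - PowerSeries.X) ^ (n + d) *
      PowerSeries.mk (fun m => (latticeCount d n P m : ℤ)) = (δ : PowerSeries ℤ)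

/-- Membership in the matroid `M_B`: the index set `F` corresponds to a linearly
independent subset of the configuration. -/
def memMatroid (d n : ℕ) (b : Fin n → Fin d → ℤ) (F : Finset (Fin n)) : Prop :=
  LinearIndependent ℝ (fun i : F => toR d (b i.1))

/-- The linear span of the vectors indexed by `F`. -/
def spanF (d n : ℕ) (b : Fin n → Fin d → ℤ) (F : Finset (Fin n)) : Submodule ℝ (Fin d → ℝ) :=
  Submodule.span ℝ ((fun i => toR d (b i)) '' F)

/-- The dimension of an element `F` of the matroid: the dimension of its span. -/
def dimF (d n : ℕ) (b : Fin n → Fin d → ℤ) (F : Finset (Fin n)) : ℕ :=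
  Module.finrank ℝ (spanF d n b F)

/-- `BOX(F) = { Σ_{i ∈ F} α_i b_i  :  0 < α_i < 1 }`; `BOX(∅) = {0}`. -/
def box (d n : ℕ) (b : Fin n → Fin d → ℤ) (F : Finset (Fin n)) : Set (Fin d → ℝ) :=
  {x | ∃ α : Fin n → ℝ, (∀ i ∈ F, 0 < α i ∧ α i < 1) ∧ x = ∑ i ∈ F, α i • toR d (b i)}

/-- The number of lattice points in `BOX(F)`. -/
def boxCount (d n : ℕ) (b : Fin n → Fin d → ℤ) (F : Finset (Fin n)) : ℕ :=
  Nat.card {z : Fin d → ℤ | toR d z ∈ box d n b F}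

/-- Membership in the restricted matroid `M_F`: the index set `G` corresponds to a linearly
independent subset of the induced configuration `B_F` in `ℝ^d / Span F`. -/
def memMatroidRes (d n : ℕ) (b : Fin n → Fin d → ℤ) (F G : Finset (Fin n)) : Prop :=
  (∀ i ∈ G, toR d (b i) ∉ spanF d n b F) ∧
    LinearIndependent ℝ (fun i : G => (spanF d n b F).mkQ (toR d (b i.1)))

/-- The dimension of an element `G` of the restricted matroid `M_F`: the dimension of the
span of the corresponding vectors in `ℝ^d / Span F`. -/
def dimRes (d n : ℕ) (b : Fin n → Fin d → ℤ) (F G : Finset (Fin n)) : ℕ :=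
  Module.finrank ℝ (Submodule.span ℝ ((fun i => (spanF d n b F).mkQ (toR d (b i))) '' G))

/-- `f_i`: the number of elements of the restricted matroid `M_F` of dimension `i`. -/
def fRes (d n : ℕ) (b : Fin n → Fin d → ℤ) (F : Finset (Fin n)) (i : ℕ) : ℕ :=
  Nat.card {G : Finset (Fin n) | memMatroidRes d n b F G ∧ dimRes d n b F G = i}

/-- The `h`-polynomial `h_F(t) = Σ_{i=0}^{codim F} f_i t^i (1-t)^{codim F - i}` of `M_F`. -/
def hPoly (d n : ℕ) (b : Fin n → Fin d → ℤ) (F : Finset (Fin n)) : Polynomial ℤ :=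
  ∑ i ∈ Finset.range (d - dimF d n b F + 1),
    C (fRes d n b F i : ℤ) * X ^ i * (1 - X) ^ (d - dimF d n b F - i)

/-- The hyperplane `H_i = {u : ⟨u, b_i⟩ = r_i}`. -/
def hyperplane (d n : ℕ) (b : Fin n → Fin d → ℤ) (r : Fin n → ℝ) (i : Fin n) :
    Set (Fin d → ℝ) :=
  {u | ∑ j, u j * (b i j : ℝ) = r i}

/-- The arrangement `H` is simple: the intersection of any `l` of the hyperplanes is
either empty or has codimension `l`. -/
def Simple (d n : ℕ) (b : Fin n → Fin d → ℤ) (r : Fin n → ℝ) : Prop :=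
  ∀ s : Finset (Fin n), (⋂ i ∈ s, hyperplane d n b r i) = ∅ ∨
    ∀ x ∈ ⋂ i ∈ s, hyperplane d n b r i,
      Module.finrank ℝ
        (Submodule.span ℝ ((fun u => u - x) '' ⋂ i ∈ s, hyperplane d n b r i)) + s.card = d

/-- The affine subspace `A_F = ⋂_{i ∈ F} H_i`. -/
def flat (d n : ℕ) (b : Fin n → Fin d → ℤ) (r : Fin n → ℝ) (F : Finset (Fin n)) :
    Set (Fin d → ℝ) :=
  ⋂ i ∈ F, hyperplane d n b r i

/-- The cell of the restricted arrangement `H^F` containing the point `u ∈ A_F`: all points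
of `A_F` satisfying the same relations `<`, `=`, `>` as `u` with respect to each hyperplane
of `H^F`. -/
def cellOf (d n : ℕ) (b : Fin n → Fin d → ℤ) (r : Fin n → ℝ) (F : Finset (Fin n))
    (u : Fin d → ℝ) : Set (Fin d → ℝ) :=
  {v ∈ flat d n b r F | ∀ i : Fin n, toR d (b i) ∉ spanF d n b F →
    (((∑ j, v j * (b i j : ℝ)) < r i ↔ (∑ j, u j * (b i j : ℝ)) < r i) ∧
      ((∑ j, v j * (b i j : ℝ)) = r i ↔ (∑ j, u j * (b i j : ℝ)) = r i))}

/-- `f^bd_k`: the number of bounded cells of the restricted arrangement `H^F` of dimension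
`k` (the dimension of a cell being the dimension of its affine span). -/
def fBd (d n : ℕ) (b : Fin n → Fin d → ℤ) (r : Fin n → ℝ) (F : Finset (Fin n)) (k : ℕ) : ℕ :=
  Nat.card {Cs : Set (Fin d → ℝ) | (∃ u ∈ flat d n b r F, Cs = cellOf d n b r F u) ∧
    Bornology.IsBounded Cs ∧ Module.finrank ℝ (vectorSpan ℝ Cs) = k}

/-- `h^bd_F(t) = Σ_{i=0}^{codim F} f^bd_i (t-1)^i`. -/
def hBdPoly (d n : ℕ) (b : Fin n → Fin d → ℤ) (r : Fin n → ℝ) (F : Finset (Fin n)) :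
    Polynomial ℤ :=
  ∑ i ∈ Finset.range (d - dimF d n b F + 1), C (fBd d n b r F i : ℤ) * (X - 1) ^ i

/-- The complement within `A_F` of the union of the hyperplanes of `H^F`. -/
def arrComplement (d n : ℕ) (b : Fin n → Fin d → ℤ) (r : Fin n → ℝ) (F : Finset (Fin n)) :
    Set (Fin d → ℝ) :=
  flat d n b r F \ ⋃ i ∈ {i : Fin n | toR d (b i) ∉ spanF d n b F}, hyperplane d n b r i

/-- `R^bd_F`: the number of bounded regions (connected components of the complement within
`A_F` of the union of the hyperplanes) of the restricted arrangement `H^F`. -/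
def boundedRegionCount (d n : ℕ) (b : Fin n → Fin d → ℤ) (r : Fin n → ℝ)
    (F : Finset (Fin n)) : ℕ :=
  Nat.card {R : Set (Fin d → ℝ) | (∃ x ∈ arrComplement d n b r F,
    R = connectedComponentIn (arrComplement d n b r F) x) ∧ Bornology.IsBounded R}

/-- `F` is a maximal linearly independent subset of the configuration. -/
def IsMaximalIndep (d n : ℕ) (b : Fin n → Fin d → ℤ) (F : Finset (Fin n)) : Prop :=
  memMatroid d n b F ∧ ∀ G : Finset (Fin n), memMatroid d n b G → F ⊆ G → F = G

/-- The matroid `M_B` is coloop free: no element of the configuration lies in every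
maximal linearly independent subset. -/
def ColoopFree (d n : ℕ) (b : Fin n → Fin d → ℤ) : Prop :=
  ∀ i : Fin n, ∃ F : Finset (Fin n), IsMaximalIndep d n b F ∧ i ∉ F

/-- `f_i`: the number of elements of the matroid `M_B` of dimension `i`. -/
def fMat (d n : ℕ) (b : Fin n → Fin d → ℤ) (i : ℕ) : ℕ :=
  Nat.card {F : Finset (Fin n) | memMatroid d n b F ∧ dimF d n b F = i}


/-! ### Top-heavy polynomials -/

/-- The coefficients of `q` are nonnegative and satisfy `q_i ≤ q_j` whenever `i ≤ j ≤ r - i`. -/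
def IsTopHeavy (r : ℕ) (q : ℤ[X]) : Prop :=
  (∀ j, 0 ≤ q.coeff j) ∧ ∀ i j, i ≤ j → i + j ≤ r → q.coeff i ≤ q.coeff j

namespace IsTopHeavy

variable {r : ℕ} {p q : ℤ[X]}

theorem add (hp : IsTopHeavy r p) (hq : IsTopHeavy r q) : IsTopHeavy r (p + q) := by
  refine ⟨fun j => ?_, fun i j hij hj => ?_⟩
  · rw [coeff_add]; exact add_nonneg (hp.1 j) (hq.1 j)
  · rw [coeff_add, coeff_add]; exact add_le_add (hp.2 i j hij hj) (hq.2 i j hij hj)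

theorem zero (r : ℕ) : IsTopHeavy r 0 := ⟨fun _ => by simp, fun _ _ _ _ => by simp⟩

theorem one : IsTopHeavy 0 1 := by
  refine ⟨fun j => ?_, fun i j _ hj => ?_⟩
  · rw [coeff_one]; split_ifs <;> simp
  · obtain ⟨rfl, rfl⟩ : i = 0 ∧ j = 0 := by omega
    exact le_rfl

theorem sum {ι : Type*} (t : Finset ι) (f : ι → ℤ[X]) (h : ∀ x ∈ t, IsTopHeavy r (f x)) :
    IsTopHeavy r (∑ x ∈ t, f x) := by
  induction t using Finset.induction_on with
  | empty => simpa using zero r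
  | insert a t ha ih =>
    rw [Finset.sum_insert ha]
    exact (h a (by simp)).add (ih fun x hx => h x (by simp [hx]))

theorem natCast_mul (hq : IsTopHeavy r q) (c : ℕ) : IsTopHeavy r (C (c : ℤ) * q) := by
  refine ⟨fun j => ?_, fun i j hij hj => ?_⟩
  · rw [coeff_C_mul]; exact mul_nonneg (by positivity) (hq.1 j)
  · rw [coeff_C_mul, coeff_C_mul]
    exact mul_le_mul_of_nonneg_left (hq.2 i j hij hj) (by positivity)

theorem X_pow_mul (hq : IsTopHeavy r q) (k : ℕ) : IsTopHeavy (r + k) (X ^ k * q) := by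
  refine ⟨fun j => ?_, fun i j hij hj => ?_⟩
  · rw [coeff_X_pow_mul']; split_ifs
    exacts [hq.1 _, le_rfl]
  · rw [coeff_X_pow_mul', coeff_X_pow_mul']
    split_ifs with h1 h2
    · exact hq.2 _ _ (by omega) (by omega)
    · omega
    · exact hq.1 _
    · exact le_rfl

theorem geom_sum_mul (hq : IsTopHeavy r q) (s : ℕ) :
    IsTopHeavy (r + s) ((∑ k ∈ Finset.range (s + 1), X ^ k) * q) := by
  let Q : ℤ → ℤ := fun z => if 0 ≤ z then q.coeff z.toNat else 0
  have Qnn : ∀ z, 0 ≤ Q z := fun z => by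
    simp only [Q]; split_ifs
    exacts [hq.1 _, le_rfl]
  have Qle : ∀ y z : ℤ, y ≤ z → y + z ≤ r → Q y ≤ Q z := fun y z hyz hr => by
    by_cases hy : 0 ≤ y
    · simp only [Q, if_pos hy, if_pos (hy.trans hyz)]
      exact hq.2 _ _ (by omega) (by omega)
    · simpa only [Q, if_neg hy] using Qnn z
  have hcoeff : ∀ j : ℕ, ((∑ k ∈ Finset.range (s + 1), X ^ k) * q).coeff j =
      ∑ k ∈ Finset.range (s + 1), Q (j - k) := fun j => by
    rw [Finset.sum_mul, finsetSum_coeff]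
    refine Finset.sum_congr rfl fun k _ => ?_
    rw [coeff_X_pow_mul']
    simp only [Q, sub_nonneg, Nat.cast_le]
    split_ifs with h
    · congr 1; omega
    · rfl
  have htel : ∀ (i : ℤ) (m : ℕ), ∑ k ∈ Finset.range (s + 1), Q (i + m - k) =
      ∑ k ∈ Finset.range (s + 1), Q (i - k) +
        ∑ u ∈ Finset.range m, (Q (i + m - u) - Q (i - s + u)) := fun i m => by
    have hshift : ∀ z : ℤ, ∑ k ∈ Finset.range (s + 1), Q (z + 1 - k) =
        ∑ k ∈ Finset.range (s + 1), Q (z - k) + (Q (z + 1) - Q (z - s)) := fun z => by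
      rw [Finset.sum_range_succ', Finset.sum_range_succ]
      simp only [Nat.cast_add, Nat.cast_one, add_sub_add_right_eq_sub, Nat.cast_zero, sub_zero]
      ring
    have hrefl : ∑ u ∈ Finset.range m, Q (i + m - u) = ∑ u ∈ Finset.range m, Q (i + 1 + u) := by
      rw [← Finset.sum_range_reflect]
      refine Finset.sum_congr rfl fun u hu => ?_
      have := Finset.mem_range.1 hu
      congr 1; omega
    rw [Finset.sum_sub_distrib, hrefl, ← Finset.sum_sub_distrib]
    clear hrefl
    induction m with
    | zero => simp
    | succ m ih =>
      rw [Finset.sum_range_succ _ m, ← add_assoc, ← ih]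
      have := hshift (i + m)
      push_cast
      rw [← add_assoc, this]
      congr 3 <;> ring
  refine ⟨fun j => ?_, fun i j hij hj => ?_⟩
  · rw [hcoeff]; exact Finset.sum_nonneg fun _ _ => Qnn _
  · rw [hcoeff, hcoeff]
    obtain ⟨m, rfl⟩ := Nat.exists_eq_add_of_le hij
    by_cases hm : m ≤ s
    · have := htel i m
      push_cast
      rw [this]
      refine le_add_of_nonneg_right (Finset.sum_nonneg fun u hu => sub_nonneg.2 ?_)
      have := Finset.mem_range.1 hu
      exact Qle _ _ (by omega) (by omega)
    · rw [← Finset.sum_range_reflect]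
      refine Finset.sum_le_sum fun u hu => ?_
      have := Finset.mem_range.1 hu
      exact Qle _ _ (by push_cast; omega) (by push_cast; omega)

end IsTopHeavy

/-! ### The `h`-polynomial of a vector configuration without coloops -/

section VectorConfiguration

variable {ι K V : Type*} [Field K] [AddCommGroup V] [Module K V]

theorem linearIndepOn_union_of_notMem_span {b : ι → V} {N : Set ι} {F T : Finset ι}
    (hF : LinearIndepOn K b (F : Set ι)) (hFN : (F : Set ι) ⊆ N) (hTN : (T : Set ι) ⊆ N)
    (hT : ∀ c ∈ T, b c ∉ Submodule.span K (b '' (N \ {c}))) :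
    LinearIndepOn K b ((T ∪ F : Finset ι) : Set ι) := by
  induction T using Finset.induction_on with
  | empty => simpa using hF
  | insert a T ha ih =>
    have ih := ih (fun x hx => hTN (by simp_all)) (fun c hc => hT c (by simp [hc]))
    by_cases haF : a ∈ F
    · rwa [Finset.insert_union, Finset.insert_eq_of_mem (Finset.mem_union_right _ haF)]
    rw [Finset.insert_union, Finset.coe_insert]
    refine ih.insert fun h => hT a (by simp) (Submodule.span_mono (Set.image_mono ?_) h)
    intro x hx
    have hx' : x ∈ T ∨ x ∈ F := by simpa using hx
    refine ⟨?_, ?_⟩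
    · rcases hx' with h | h
      exacts [hTN (by simp [h]), hFN h]
    · rintro rfl
      exact hx'.elim ha haF

theorem exists_finset_basis (b : ι → V) (E : Finset ι) :
    ∃ F ⊆ E, LinearIndepOn K b (F : Set ι) ∧
      Submodule.span K (b '' F) = Submodule.span K (b '' E) := by
  obtain ⟨F, hFE, -, hspan, hF⟩ :=
    exists_linearIndepOn_extension (linearIndepOn_empty K b) (Set.empty_subset (E : Set ι))
  lift F to Finset ι using E.finite_toSet.subset hFE
  exact ⟨F, by simpa using hFE, hF,
    le_antisymm (Submodule.span_mono (Set.image_mono hFE)) (Submodule.span_le.2 hspan)⟩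

theorem finrank_span_image_eq_card {b : ι → V} {F : Finset ι}
    (hF : LinearIndepOn K b (F : Set ι)) :
    Module.finrank K (Submodule.span K (b '' F)) = F.card := by
  have := finrank_span_eq_card (R := K) (b := fun i : F => b i) hF
  rw [Set.image_eq_range]
  simpa using this

theorem card_le_finrank_span {b : ι → V} {E F : Finset ι} (hFE : F ⊆ E)
    (hF : LinearIndepOn K b (F : Set ι)) :
    F.card ≤ Module.finrank K (Submodule.span K (b '' E)) := by
  rw [← finrank_span_image_eq_card hF]
  have : FiniteDimensional K (Submodule.span K (b '' (E : Set ι))) :=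
    FiniteDimensional.span_of_finite K (E.finite_toSet.image b)
  exact Submodule.finrank_mono (Submodule.span_mono (Set.image_mono (by exact_mod_cast hFE)))

theorem mem_span_of_mem_span_union {b : ι → V} {N : Set ι} {T : Finset ι} {Y : Set ι} {i : ι}
    (hiN : i ∈ N) (hYN : Y ⊆ N) (hTN : (T : Set ι) ⊆ N) (hiT : i ∉ T) (hTY : ∀ c ∈ T, c ∉ Y)
    (hT : ∀ c ∈ T, b c ∉ Submodule.span K (b '' (N \ {c})))
    (h : b i ∈ Submodule.span K (b '' (T ∪ Y))) : b i ∈ Submodule.span K (b '' Y) := by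
  induction T using Finset.induction_on with
  | empty => simpa using h
  | insert a T ha ih =>
    refine ih (fun x hx => hTN (by simp_all)) (by simp_all)
      (fun c hc => hTY c (by simp [hc])) (fun c hc => hT c (by simp [hc])) ?_
    by_contra hn
    rw [Finset.coe_insert, Set.insert_union, Set.image_insert_eq] at h
    have := mem_span_insert_exchange h hn
    rw [← Set.image_insert_eq] at this
    refine hT a (by simp) (Submodule.span_mono (Set.image_mono ?_) this)
    have haY : a ∉ Y := hTY a (by simp)
    have hia : i ≠ a := by rintro rfl; simp at hiT
    rintro x (rfl | hx | hx)
    · exact ⟨hiN, hia⟩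
    · exact ⟨hTN (by simp_all), by rintro rfl; exact ha hx⟩
    · exact ⟨hYN hx, by rintro rfl; exact haY hx⟩

/-- The `h`-polynomial of the matroid of the vectors `b i`, `i ∈ E`. -/
def configHPoly (K : Type*) {ι V : Type*} [Field K] [AddCommGroup V] [Module K V]
    (b : ι → V) (E : Finset ι) : ℤ[X] :=
  ∑ F ∈ E.powerset.filter (fun F : Finset ι => LinearIndepOn K b (F : Set ι)),
    X ^ F.card * (1 - X) ^ (Module.finrank K (Submodule.span K (b '' E)) - F.card)

theorem sum_ssubsets_pow_mul_pow (S : Finset ι) (hS : S.Nonempty) :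
    ∑ T ∈ S.ssubsets, (X : ℤ[X]) ^ T.card * (1 - X) ^ (S.card - 1 - T.card) =
      ∑ k ∈ Finset.range (S.card - 1 + 1), X ^ k := by
  have h1 : (1 - X : ℤ[X]) ≠ 0 := fun h => by
    have := congrArg (fun p => p.coeff 0) h
    simp at this
  apply mul_left_cancel₀ h1
  have hc := hS.card_pos
  rw [Nat.sub_add_cancel hc, mul_comm, mul_comm _ (∑ k ∈ _, _), geom_sum_mul_neg, Finset.sum_mul]
  have := Finset.sum_pow_mul_eq_add_pow (X : ℤ[X]) (1 - X) S
  rw [add_sub_cancel, one_pow, ← Finset.sum_erase_add _ _ (Finset.mem_powerset_self S)] at this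
  rw [Nat.sub_self, pow_zero, mul_one] at this
  refine Eq.trans (Finset.sum_congr rfl fun T hT => ?_) (eq_sub_of_add_eq this)
  have := Finset.card_lt_card (Finset.mem_ssubsets.1 hT)
  rw [mul_assoc, ← pow_succ]
  congr 2; omega

theorem sum_powerset_union_disjoint {M : Type*} [AddCommMonoid M] {S E : Finset ι}
    (h : Disjoint S E) (f : Finset ι → M) :
    ∑ F ∈ (S ∪ E).powerset, f F = ∑ T ∈ S.powerset, ∑ F ∈ E.powerset, f (T ∪ F) := by
  rw [← Finset.sum_product']
  refine Finset.sum_nbij' (fun F => (F ∩ S, F ∩ E)) (fun p => p.1 ∪ p.2) ?_ ?_ ?_ ?_ ?_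
  · intro F hF; simp
  · rintro ⟨T, F⟩ hp
    simp only [Finset.mem_product, Finset.mem_powerset] at hp ⊢
    exact Finset.union_subset_union hp.1 hp.2
  · intro F hF
    rw [Finset.mem_powerset] at hF
    simp only
    rw [← Finset.inter_union_distrib_left, Finset.inter_eq_left.2 hF]
  · rintro ⟨T, F⟩ hp
    simp only [Finset.mem_product, Finset.mem_powerset] at hp
    have h1 : ∀ x, x ∈ S → x ∉ E := fun x hx => Finset.disjoint_left.1 h hx
    have h2 : ∀ x, x ∈ T → x ∈ S := fun x hx => hp.1 hx
    have h3 : ∀ x, x ∈ F → x ∈ E := fun x hx => hp.2 hx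
    ext x <;> simp only [Finset.mem_inter, Finset.mem_union] <;> grind
  · intro F hF
    rw [Finset.mem_powerset] at hF
    simp only
    rw [← Finset.inter_union_distrib_left, Finset.inter_eq_left.2 hF]

theorem finrank_span_mkQ_add_card {b : ι → V} {S E : Finset ι} (hdisj : Disjoint S E)
    (hS : LinearIndepOn K b (S : Set ι)) :
    S.card + Module.finrank K (Submodule.span K
        (((Submodule.span K (b '' S)).mkQ ∘ b) '' E)) =
      Module.finrank K (Submodule.span K (b '' ((S : Set ι) ∪ E))) := by
  rw [← Finset.coe_union]
  obtain ⟨F, hFE, hF, hspan⟩ := exists_finset_basis (K := K) ((Submodule.span K (b '' S)).mkQ ∘ b) E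
  have hdF : Disjoint S F := hdisj.mono_right hFE
  have hSF : LinearIndepOn K b ((S ∪ F : Finset ι) : Set ι) := by
    rw [Finset.coe_union]
    exact (hS.quotient_iff_union (by exact_mod_cast hdF)).1 hF
  rw [← hspan, finrank_span_image_eq_card hF, ← Finset.card_union_of_disjoint hdF,
    ← finrank_span_image_eq_card hSF]
  have hmap : ∀ Y : Finset ι, Submodule.span K (((Submodule.span K (b '' S)).mkQ ∘ b) '' Y) =
      (Submodule.span K (b '' ((S ∪ Y : Finset ι) : Set ι))).map
        (Submodule.span K (b '' S)).mkQ := fun Y => by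
    rw [Submodule.map_span, Finset.coe_union, Set.image_union, Set.image_union, Set.image_comp,
      Submodule.span_union, ← Submodule.map_span (f := (Submodule.span K (b '' (S : Set ι))).mkQ)
        (s := b '' (S : Set ι))]
    simp
  rw [hmap, hmap] at hspan
  have hle : ∀ Y : Finset ι, Submodule.span K (b '' S) ≤
      Submodule.span K (b '' ((S ∪ Y : Finset ι) : Set ι)) := fun Y =>
    Submodule.span_mono (Set.image_mono (by simp))
  have := congrArg (Submodule.comap (Submodule.span K (b '' S)).mkQ) hspan
  rw [Submodule.comap_map_mkQ, Submodule.comap_map_mkQ, sup_eq_right.2 (hle F),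
    sup_eq_right.2 (hle E)] at this
  rw [this]

theorem mem_span_mkQ_image {b : ι → V} (S : Finset ι) {Y : Set ι} {i : ι}
    (h : b i ∈ Submodule.span K (b '' (S ∪ Y))) :
    ((Submodule.span K (b '' S)).mkQ ∘ b) i ∈
      Submodule.span K (((Submodule.span K (b '' S)).mkQ ∘ b) '' Y) := by
  have h' := Submodule.mem_map_of_mem (f := (Submodule.span K (b '' S)).mkQ) h
  rw [Set.image_union, Submodule.span_union, Submodule.map_sup, Submodule.mkQ_map_self, bot_sup_eq,
    Submodule.map_span, ← Set.image_comp] at h'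
  exact h'

theorem isTopHeavy_configHPoly (b : ι → V) (E : Finset ι)
    (hE : ∀ i ∈ E, b i ∈ Submodule.span K (b '' ((E : Set ι) \ {i}))) :
    IsTopHeavy (Module.finrank K (Submodule.span K (b '' E))) (configHPoly K b E) := by
  induction hm : E.card using Nat.strong_induction_on generalizing V E with
  | _ m ih =>
  subst hm
  by_cases hzero : ∀ i ∈ E, b i = 0
  · have hspan : Submodule.span K (b '' E) = ⊥ := by
      rw [Submodule.span_eq_bot]
      rintro _ ⟨i, hi, rfl⟩
      exact hzero i hi
    have hfil : E.powerset.filter (fun F : Finset ι => LinearIndepOn K b (F : Set ι)) = {∅} := by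
      ext F
      simp only [Finset.mem_filter, Finset.mem_powerset, Finset.mem_singleton]
      constructor
      · rintro ⟨hFE, hF⟩
        refine Finset.eq_empty_of_forall_notMem fun i hi => ?_
        exact hF.ne_zero (by exact_mod_cast hi) (hzero i (hFE hi))
      · rintro rfl
        simp
    rw [configHPoly, hfil, hspan]
    simpa using IsTopHeavy.one
  push Not at hzero
  obtain ⟨e, heE, he0⟩ := hzero
  let S : Finset ι := insert e ((E.erase e).filter
    fun i => b i ∉ Submodule.span K (b '' ((E : Set ι) \ {e, i})))
  have heS : e ∈ S := by simp [S]
  have hSE : S ⊆ E := by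
    intro x hx
    simp only [S, Finset.mem_insert, Finset.mem_filter, Finset.mem_erase] at hx
    rcases hx with rfl | hx
    exacts [heE, hx.1.2]
  have hSe : ∀ c ∈ S, c ≠ e → b c ∉ Submodule.span K (b '' ((E : Set ι) \ {e, c})) := by
    intro c hc hce
    simp only [S, Finset.mem_insert, Finset.mem_filter, Finset.mem_erase] at hc
    exact (hc.resolve_left hce).2
  have hseries : ∀ i ∈ S, ∀ c ∈ S, c ≠ i →
      b c ∉ Submodule.span K (b '' (((E : Set ι) \ {i}) \ {c})) := by
    intro i hi c hc hci h
    by_cases hie : i = e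
    · subst hie
      exact hSe c hc hci (by rwa [Set.sdiff_sdiff] at h)
    have key : ∀ x ∈ S, x ≠ e → b e ∉ Submodule.span K (b '' ((E : Set ι) \ {e, x})) := by
      intro x hx hxe hmem
      refine hSe x hx hxe ?_
      have h := hE x (hSE hx)
      have heq : (E : Set ι) \ {x} = insert e ((E : Set ι) \ {e, x}) := by
        ext x; simp; grind
      rwa [heq, Set.image_insert_eq, Submodule.span_insert_eq_span hmem] at h
    by_cases hce : c = e
    · subst hce
      refine key i hi hie (by rwa [Set.sdiff_sdiff, Set.union_comm] at h)
    have hY : ((E : Set ι) \ {i}) \ {c} = insert e ((E : Set ι) \ {e, i, c}) := by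
      ext x; simp; grind
    rw [hY, Set.image_insert_eq] at h
    have hn : b c ∉ Submodule.span K (b '' ((E : Set ι) \ {e, i, c})) := fun h =>
      hSe c hc hce (Submodule.span_mono (Set.image_mono (fun x => by simp; grind)) h)
    have := mem_span_insert_exchange h hn
    rw [← Set.image_insert_eq] at this
    refine key i hi hie (Submodule.span_mono (Set.image_mono ?_) this)
    intro x
    have := hSE hc
    simp; grind
  let E' := E \ S
  have hE'E : E' ⊆ E := Finset.sdiff_subset
  have hdisj : Disjoint S E' := Finset.disjoint_sdiff
  have hunion : S ∪ E' = E := Finset.union_sdiff_of_subset hSE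
  have hE'S : ∀ x ∈ E', x ∉ S := fun x hx => (Finset.mem_sdiff.1 hx).2
  have hcard : E'.card < E.card := Finset.card_lt_card
    ⟨hE'E, fun h => hE'S e (h heE) heS⟩
  have hSpos : 0 < S.card := Finset.card_pos.2 ⟨e, heS⟩
  have hindep : ∀ T ⊆ S, T ≠ S → ∀ F ⊆ E', LinearIndepOn K b (F : Set ι) →
      LinearIndepOn K b ((T ∪ F : Finset ι) : Set ι) := by
    intro T hTS hT F hF hFi
    obtain ⟨i, hiS, hiT⟩ : ∃ i ∈ S, i ∉ T := by
      by_contra! h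
      exact hT (hTS.antisymm h)
    refine linearIndepOn_union_of_notMem_span (N := (E : Set ι) \ {i}) hFi ?_ ?_ ?_
    · exact fun x hx => ⟨hE'E (hF hx), by rintro rfl; exact hE'S _ (hF hx) hiS⟩
    · exact fun x hx => ⟨hSE (hTS hx), by rintro rfl; exact hiT hx⟩
    · exact fun c hc => hseries i hiS c (hTS hc) (by rintro rfl; exact hiT hc)
  -- the rank drops by `S.card - 1` when `S` is deleted
  have hrank : Module.finrank K (Submodule.span K (b '' E)) =
      Module.finrank K (Submodule.span K (b '' E')) + (S.card - 1) := by
    obtain ⟨F, hFE', hF, hFspan⟩ := exists_finset_basis (K := K) b E'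
    have hdF : Disjoint (S.erase e) F :=
      (hdisj.mono_left (Finset.erase_subset _ _)).mono_right hFE'
    have hi := hindep (S.erase e) (Finset.erase_subset _ _)
      (fun h => by rw [← h] at heS; simp at heS) F hFE' hF
    rw [← hFspan, finrank_span_image_eq_card hF, ← Finset.card_erase_of_mem heS, add_comm,
      ← Finset.card_union_of_disjoint hdF, ← finrank_span_image_eq_card hi]
    suffices h : Submodule.span K (b '' E) =
        Submodule.span K (b '' ((S.erase e ∪ F : Finset ι) : Set ι)) by rw [h]
    apply le_antisymm
    · have h1 : Submodule.span K (b '' ((E : Set ι) \ {e})) = Submodule.span K (b '' E) := by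
        conv_rhs => rw [← Set.insert_sdiff_self_of_mem (show e ∈ (E : Set ι) from heE),
          Set.image_insert_eq, Submodule.span_insert_eq_span (hE e heE)]
      rw [← h1, Submodule.span_le]
      rintro _ ⟨x, ⟨hxE, hxe⟩, rfl⟩
      by_cases hxS : x ∈ S
      · exact Submodule.subset_span ⟨x, by simp_all, rfl⟩
      · have : b x ∈ Submodule.span K (b '' F) := by
          rw [hFspan]
          exact Submodule.subset_span ⟨x, Finset.mem_sdiff.2 ⟨hxE, hxS⟩, rfl⟩
        exact Submodule.span_mono (Set.image_mono (by simp)) this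
    · refine Submodule.span_mono (Set.image_mono ?_)
      exact_mod_cast Finset.union_subset ((Finset.erase_subset _ _).trans hSE) (hFE'.trans hE'E)
  have ihdel := ih _ hcard b E' (fun i hi => by
    have hie : i ≠ e := by rintro rfl; exact hE'S _ hi heS
    have hi1 : b i ∈ Submodule.span K (b '' ((E : Set ι) \ {e, i})) := by
      by_contra hn
      exact hE'S i hi (by simp [S, hie, hE'E hi, hn])
    refine mem_span_of_mem_span_union (N := (E : Set ι) \ {e}) (T := S.erase e)
      ⟨hE'E hi, hie⟩ ?_ ?_ ?_ ?_ ?_ ?_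
    · exact fun x hx => ⟨hE'E hx.1, by rintro rfl; exact hE'S _ hx.1 heS⟩
    · intro x hx
      have hx : x ≠ e ∧ x ∈ S := Finset.mem_erase.1 hx
      exact ⟨hSE hx.2, hx.1⟩
    · exact fun h => hE'S i hi (Finset.mem_of_mem_erase h)
    · exact fun c hc h => hE'S c h.1 (Finset.mem_of_mem_erase hc)
    · exact fun c hc => hseries e heS c (Finset.mem_of_mem_erase hc) (Finset.ne_of_mem_erase hc)
    · convert hi1 using 3
      ext x
      have := hE'S i hi
      have := @hSE x
      simp [E']
      grind) rfl
  have hdecomp : configHPoly K b E =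
      (∑ k ∈ Finset.range (S.card - 1 + 1), X ^ k) * configHPoly K b E' +
      ∑ F ∈ E'.powerset, if LinearIndepOn K b ((S ∪ F : Finset ι) : Set ι) then
        X ^ (S ∪ F).card *
          (1 - X) ^ (Module.finrank K (Submodule.span K (b '' E)) - (S ∪ F).card) else 0 := by
    rw [configHPoly, Finset.sum_filter, ← sum_ssubsets_pow_mul_pow S ⟨e, heS⟩]
    conv_lhs => rw [← hunion]
    rw [sum_powerset_union_disjoint hdisj, ← Finset.sum_erase_add _ _ (Finset.mem_powerset_self S),
      hunion]
    congr 1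
    rw [configHPoly, Finset.sum_filter, Finset.sum_mul_sum]
    refine Finset.sum_congr rfl fun T hT => Finset.sum_congr rfl fun F hF => ?_
    rw [Finset.mem_ssubsets, Finset.ssubset_iff_subset_ne] at hT
    rw [Finset.mem_powerset] at hF
    have hTlt : T.card < S.card :=
      Finset.card_lt_card (Finset.ssubset_iff_subset_ne.2 hT)
    by_cases hFi : LinearIndepOn K b (F : Set ι)
    · have hFle := card_le_finrank_span hF hFi
      rw [if_pos hFi, if_pos (hindep T hT.1 hT.2 F hF hFi), hrank,
        Finset.card_union_of_disjoint ((hdisj.mono_left hT.1).mono_right hF),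
        mul_mul_mul_comm, ← pow_add, ← pow_add]
      congr 2; omega
    · rw [if_neg hFi, if_neg fun h => hFi (h.mono (by simp)), mul_zero]
  rw [hdecomp]
  refine IsTopHeavy.add ?_ ?_
  · rw [hrank]
    exact ihdel.geom_sum_mul _
  by_cases hSi : LinearIndepOn K b (S : Set ι)
  · have ihcon := ih _ hcard ((Submodule.span K (b '' S)).mkQ ∘ b) E' (fun i hi =>
      mem_span_mkQ_image S (by
        convert hE i (hE'E hi) using 3
        rw [← hunion]
        ext x
        have := hE'S i hi
        simp
        grind)) rfl
    have hr := finrank_span_mkQ_add_card hdisj hSi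
    rw [← Finset.coe_union, hunion] at hr
    convert ihcon.X_pow_mul S.card using 1
    · rw [← hr, add_comm]
    · rw [configHPoly, Finset.sum_filter, Finset.mul_sum]
      refine Finset.sum_congr rfl fun F hF => ?_
      rw [Finset.mem_powerset] at hF
      have hdF := hdisj.mono_right hF
      have hiff : LinearIndepOn K b ((S ∪ F : Finset ι) : Set ι) ↔
          LinearIndepOn K ((Submodule.span K (b '' S)).mkQ ∘ b) (F : Set ι) := by
        rw [Finset.coe_union]
        exact (hSi.quotient_iff_union (by exact_mod_cast hdF)).symm
      simp only [hiff, ← hr, Finset.card_union_of_disjoint hdF, Nat.add_sub_add_left, mul_ite,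
        mul_zero, pow_add, mul_assoc]
  · rw [Finset.sum_eq_zero]
    · exact IsTopHeavy.zero _
    · exact fun F _ => if_neg fun h => hSi (h.mono (by simp))

end VectorConfiguration

/-! ### Counting lattice points of zonotopes -/

theorem ncard_biUnion_finset {α β : Type*} (t : Finset β) (A : β → Set α)
    (hfin : ∀ i ∈ t, (A i).Finite) (hdisj : ∀ i ∈ t, ∀ j ∈ t, i ≠ j → Disjoint (A i) (A j)) :
    (⋃ i ∈ t, A i).ncard = ∑ i ∈ t, (A i).ncard := by
  induction t using Finset.induction_on with
  | empty => simp
  | insert a t ha ih =>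
    have h1 : ∀ i ∈ t, (A i).Finite := fun i hi => hfin i (by simp [hi])
    have h2 : (⋃ i ∈ t, A i).Finite := t.finite_toSet.biUnion h1
    rw [Finset.set_biUnion_insert, Finset.sum_insert ha,
      Set.ncard_union_eq ?_ (hfin a (by simp)) h2,
      ih h1 fun i hi j hj => hdisj i (by simp [hi]) j (by simp [hj])]
    simp only [Set.disjoint_iUnion_right]
    exact fun i hi => hdisj a (by simp) i (by simp [hi]) (by rintro rfl; exact ha hi)

/-- Sliding a bounded interval by a unit to the right adds exactly one integer. -/
theorem exists_int_notMem_of_bddAbove {A : Set ℝ} (hne : A.Nonempty) (hbd : BddAbove A) :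
    ∃ k : ℤ, (k : ℝ) ∉ A ∧ ∃ τ : ℝ, 0 ≤ τ ∧ τ ≤ 1 ∧ (k : ℝ) - τ ∈ A := by
  obtain ⟨t, ht⟩ := hne
  obtain ⟨M, hM⟩ := hbd
  obtain ⟨k, ⟨s, hsA, hs1, hs2⟩, hmax⟩ := Int.exists_greatest_of_bdd
    (P := fun k : ℤ => ∃ s ∈ A, s ≤ k ∧ (k : ℝ) - 1 ≤ s)
    ⟨⌈M⌉ + 1, by
      rintro z ⟨s, hs, -, hz⟩
      have h1 := hM hs
      have h2 := Int.le_ceil M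
      have : (z : ℝ) ≤ ((⌈M⌉ + 1 : ℤ) : ℝ) := by push_cast; linarith
      exact_mod_cast this⟩
    ⟨⌈t⌉, t, ht, Int.le_ceil t, by linarith [Int.ceil_lt_add_one t]⟩
  refine ⟨k, fun hk => ?_, k - s, by linarith, by linarith, by simpa using hsA⟩
  have := hmax (k + 1) ⟨k, hk, by push_cast; linarith, by push_cast; linarith⟩
  omega

theorem int_eq_of_notMem_of_ordConnected {A : Set ℝ} (hA : A.OrdConnected) {k l : ℤ}
    (hk : (k : ℝ) ∉ A) (hl : (l : ℝ) ∉ A)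
    (hk' : ∃ τ : ℝ, 0 ≤ τ ∧ τ ≤ 1 ∧ (k : ℝ) - τ ∈ A)
    (hl' : ∃ τ : ℝ, 0 ≤ τ ∧ τ ≤ 1 ∧ (l : ℝ) - τ ∈ A) : k = l := by
  wlog h : k < l generalizing k l
  · by_contra hne
    exact hne (this hl hk hl' hk' (by omega)).symm
  obtain ⟨σ, hσ0, hσ1, hσ⟩ := hk'
  obtain ⟨τ, hτ0, hτ1, hτ⟩ := hl'
  have hkl : (k : ℝ) + 1 ≤ l := by exact_mod_cast h
  exact absurd (hA.out hσ hτ ⟨by linarith, by linarith⟩) hk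

section Zonotope

variable {d n : ℕ} (b : Fin n → Fin d → ℤ)

theorem toR_add (x y : Fin d → ℤ) : toR d (x + y) = toR d x + toR d y := by
  ext j; simp [toR]

theorem toR_smul (k : ℤ) (x : Fin d → ℤ) : toR d (k • x) = (k : ℝ) • toR d x := by
  ext j; simp [toR]

theorem toR_sum {κ : Type*} (s : Finset κ) (f : κ → Fin d → ℤ) :
    toR d (∑ i ∈ s, f i) = ∑ i ∈ s, toR d (f i) := by
  ext j; simp [toR]

/-- The Minkowski sum of the segments `[0, a i • b i]`, `i ∉ G`, and the lines spanned by
`b i`, `i ∈ G`. -/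
def zono (G : Finset (Fin n)) (a : Fin n → ℕ) : Set (Fin d → ℝ) :=
  {y | ∃ c : Fin n → ℝ, (∀ i, i ∉ G → 0 ≤ c i ∧ c i ≤ a i) ∧ y = ∑ i, c i • toR d (b i)}

/-- The lattice points of `zono b G a`. -/
def zonoPts (G : Finset (Fin n)) (a : Fin n → ℕ) : Set (Fin d → ℤ) :=
  {x | toR d x ∈ zono b G a}

/-- The lattice generated by the `b i`, `i ∈ G`. -/
def latSpan (G : Finset (Fin n)) : Submodule ℤ (Fin d → ℤ) := Submodule.span ℤ (b '' G)

/-- The lattice points of `zono b G a` modulo the lattice generated by the `b i`, `i ∈ G`. -/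
def zonoCosets (G : Finset (Fin n)) (a : Fin n → ℕ) : Set ((Fin d → ℤ) ⧸ latSpan b G) :=
  (latSpan b G).mkQ '' zonoPts b G a

variable {b}

theorem zono_convex (G : Finset (Fin n)) (a : Fin n → ℕ) : Convex ℝ (zono b G a) := by
  rintro _ ⟨c, hc, rfl⟩ _ ⟨c', hc', rfl⟩ s t hs ht hst
  refine ⟨fun i => s * c i + t * c' i, fun i hi => ?_, ?_⟩
  · obtain ⟨h1, h2⟩ := hc i hi
    obtain ⟨h3, h4⟩ := hc' i hi
    refine ⟨by positivity, ?_⟩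
    calc s * c i + t * c' i ≤ s * a i + t * a i := by gcongr
      _ = a i := by rw [← add_mul, hst, one_mul]
  · simp only [add_smul, mul_smul, Finset.sum_add_distrib, Finset.smul_sum]

theorem sum_update_smul (c : Fin n → ℝ) (i : Fin n) (t : ℝ) (v : Fin n → Fin d → ℝ) :
    ∑ j, Function.update c i (c i + t) j • v j = (∑ j, c j • v j) + t • v i := by
  have h : ∀ j, Function.update c i (c i + t) j • v j =
      c j • v j + (if j = i then t • v i else 0) := fun j => by
    by_cases hj : j = i
    · subst hj; simp [add_smul]
    · simp [hj]
  simp only [h, Finset.sum_add_distrib, Finset.sum_ite_eq', Finset.mem_univ, if_true]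

theorem mem_zono_succ {G : Finset (Fin n)} {i : Fin n} (hi : i ∉ G) (a : Fin n → ℕ)
    (y : Fin d → ℝ) :
    y ∈ zono b G (Function.update a i (a i + 1)) ↔
      ∃ τ : ℝ, 0 ≤ τ ∧ τ ≤ 1 ∧ y - τ • toR d (b i) ∈ zono b G a := by
  constructor
  · rintro ⟨c, hc, rfl⟩
    have hci := hc i hi
    simp only [Function.update_self, Nat.cast_add, Nat.cast_one] at hci
    refine ⟨max 0 (c i - a i), le_max_left _ _, max_le zero_le_one (by linarith), ?_⟩
    refine ⟨Function.update c i (c i + -max 0 (c i - a i)), fun j hj => ?_, ?_⟩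
    · by_cases hji : j = i
      · subst hji
        simp only [Function.update_self]
        rcases max_cases 0 (c j - a j) with h | h
        · rw [h.1]
          constructor <;> linarith
        · have : (0 : ℝ) ≤ a j := by positivity
          rw [h.1]
          constructor <;> linarith
      · have := hc j hj
        simpa [hji] using this
    · rw [sum_update_smul, neg_smul, sub_eq_add_neg]
  · rintro ⟨τ, h0, h1, c, hc, hy⟩
    refine ⟨Function.update c i (c i + τ), fun j hj => ?_, ?_⟩
    · by_cases hji : j = i
      · subst hji
        have := hc j hj
        simp only [Function.update_self, Nat.cast_add, Nat.cast_one]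
        constructor <;> linarith
      · have := hc j hj
        simpa [hji] using this
    · rw [sum_update_smul, ← hy, sub_add_cancel]

theorem mem_zono_insert {G : Finset (Fin n)} {i : Fin n} (a : Fin n → ℕ)
    (y : Fin d → ℝ) :
    y ∈ zono b (insert i G) a ↔ ∃ τ : ℝ, y + τ • toR d (b i) ∈ zono b G a := by
  constructor
  · rintro ⟨c, hc, rfl⟩
    refine ⟨-c i, Function.update c i (c i + -c i), fun j hj => ?_, ?_⟩
    · by_cases hji : j = i
      · subst hji; simp
      · simpa [hji] using hc j (by simp [hji, hj])
    · rw [sum_update_smul]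
  · rintro ⟨τ, c, hc, hy⟩
    refine ⟨Function.update c i (c i + -τ), fun j hj => ?_, ?_⟩
    · rw [Finset.mem_insert, not_or] at hj
      simpa [hj.1] using hc j hj.2
    · rw [sum_update_smul, ← hy, neg_smul, add_neg_cancel_right]

theorem zono_add_sum {G : Finset (Fin n)} {a : Fin n → ℕ} {y : Fin d → ℝ} (hy : y ∈ zono b G a)
    {c : Fin n → ℝ} (hc : ∀ i, i ∉ G → c i = 0) :
    y + ∑ i, c i • toR d (b i) ∈ zono b G a := by
  obtain ⟨c', hc', rfl⟩ := hy
  refine ⟨c' + c, fun i hi => ?_, ?_⟩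
  · simpa [hc i hi] using hc' i hi
  · simp [add_smul, Finset.sum_add_distrib]

theorem exists_coeff_of_mem_span {G : Finset (Fin n)} {y : Fin d → ℝ}
    (hy : y ∈ spanF d n b G) :
    ∃ c : Fin n → ℝ, (∀ i, i ∉ G → c i = 0) ∧ y = ∑ i, c i • toR d (b i) := by
  obtain ⟨c, hc⟩ := (Submodule.mem_span_image_finset_iff_exists_fun' ℝ).1 hy
  refine ⟨fun i => if i ∈ G then c i else 0, fun i hi => by simp [hi], ?_⟩
  simp [← hc, ite_smul]

theorem exists_coeff_of_mem_latSpan {G : Finset (Fin n)} {y : Fin d → ℤ}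
    (hy : y ∈ latSpan b G) :
    ∃ c : Fin n → ℤ, (∀ i, i ∉ G → c i = 0) ∧ y = ∑ i, c i • b i := by
  obtain ⟨c, hc⟩ := (Submodule.mem_span_image_finset_iff_exists_fun' ℤ).1 hy
  refine ⟨fun i => if i ∈ G then c i else 0, fun i hi => by simp [hi], ?_⟩
  simp only [← hc, ite_smul, zero_smul, Finset.sum_ite_mem, Finset.univ_inter]

theorem toR_mem_spanF {G : Finset (Fin n)} {y : Fin d → ℤ} (hy : y ∈ latSpan b G) :
    toR d y ∈ spanF d n b G := by
  obtain ⟨c, hc, rfl⟩ := exists_coeff_of_mem_latSpan hy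
  simp only [toR_sum, toR_smul]
  refine Submodule.sum_mem _ fun i _ => ?_
  by_cases hi : i ∈ G
  · exact Submodule.smul_mem _ _ (Submodule.subset_span ⟨i, hi, rfl⟩)
  · simp [hc i hi]

theorem zono_add_mem_span {G : Finset (Fin n)} {a : Fin n → ℕ} {y z : Fin d → ℝ}
    (hy : y ∈ zono b G a) (hz : z ∈ spanF d n b G) : y + z ∈ zono b G a := by
  obtain ⟨c, hc, rfl⟩ := exists_coeff_of_mem_span hz
  exact zono_add_sum hy hc

theorem zonoPts_of_sub_mem {G : Finset (Fin n)} {a : Fin n → ℕ} {x y : Fin d → ℤ}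
    (hx : x ∈ zonoPts b G a) (hxy : y - x ∈ latSpan b G) : y ∈ zonoPts b G a := by
  have := zono_add_mem_span (hx : toR d x ∈ zono b G a) (toR_mem_spanF hxy)
  rwa [← toR_add, add_sub_cancel] at this

theorem zono_succ_of_mem_span {G : Finset (Fin n)} {i : Fin n} (hi : i ∉ G)
    (hspan : toR d (b i) ∈ spanF d n b G) (a : Fin n → ℕ) :
    zono b G (Function.update a i (a i + 1)) = zono b G a := by
  ext y
  rw [mem_zono_succ hi]
  constructor
  · rintro ⟨τ, -, -, h⟩
    simpa using zono_add_mem_span h (Submodule.smul_mem _ τ hspan)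
  · exact fun h => ⟨0, le_rfl, zero_le_one, by simpa using h⟩

theorem zono_update_of_mem {G : Finset (Fin n)} {i : Fin n} (hi : i ∈ G) (a : Fin n → ℕ)
    (k : ℕ) : zono b G (Function.update a i k) = zono b G a := by
  have h : ∀ j, j ∉ G → Function.update a i k j = a j := fun j hj =>
    Function.update_of_ne (by rintro rfl; exact hj hi) _ _
  ext y
  constructor <;> rintro ⟨c, hc, rfl⟩ <;> refine ⟨c, fun j hj => ?_, rfl⟩
  · simpa only [h j hj] using hc j hj
  · simpa only [h j hj] using hc j hj

theorem bddAbove_line {G : Finset (Fin n)} {i : Fin n}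
    (hspan : toR d (b i) ∉ spanF d n b G) (a : Fin n → ℕ) (y : Fin d → ℝ) :
    BddAbove {τ : ℝ | y + τ • toR d (b i) ∈ zono b G a} := by
  obtain ⟨f, hf, hker⟩ := Submodule.exists_le_ker_of_notMem hspan
  let g := (f (toR d (b i)))⁻¹ • f
  have hg : g (toR d (b i)) = 1 := by simp [g, hf]
  have hgG : ∀ j ∈ G, g (toR d (b j)) = 0 := fun j hj => by
    have : f (toR d (b j)) = 0 := hker (Submodule.subset_span ⟨j, hj, rfl⟩)
    simp [g, this]
  refine ⟨∑ j, (a j : ℝ) * |g (toR d (b j))| - g y, ?_⟩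
  rintro τ ⟨c, hc, hy⟩
  have := congrArg g hy
  simp only [map_add, map_smul, map_sum, smul_eq_mul, hg, mul_one] at this
  rw [le_sub_iff_add_le, add_comm, this]
  refine Finset.sum_le_sum fun j _ => ?_
  by_cases hj : j ∈ G
  · simp [hgG j hj]
  · obtain ⟨h0, h1⟩ := hc j hj
    calc c j * g (toR d (b j)) ≤ c j * |g (toR d (b j))| := by gcongr; exact le_abs_self _
      _ ≤ _ := by gcongr

theorem ordConnected_line (G : Finset (Fin n)) (a : Fin n → ℕ) (y v : Fin d → ℝ) :
    {τ : ℝ | y + τ • v ∈ zono b G a}.OrdConnected := by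
  refine Convex.ordConnected ?_
  intro s hs t ht p q hp hq hpq
  have := zono_convex G a hs ht hp hq hpq
  have heq : p • (y + s • v) + q • (y + t • v) = y + (p • s + q • t) • v := by
    rw [smul_add, smul_add, add_add_add_comm, ← add_smul, hpq, one_smul, add_smul, smul_assoc,
      smul_assoc]
  rwa [heq] at this


theorem latSpan_mono {G G' : Finset (Fin n)} (h : G ⊆ G') : latSpan b G ≤ latSpan b G' :=
  Submodule.span_mono (Set.image_mono (Finset.coe_subset.2 h))

theorem mkQ_latSpan_eq_iff {G : Finset (Fin n)} {x y : Fin d → ℤ} :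
    (latSpan b G).mkQ x = (latSpan b G).mkQ y ↔ y - x ∈ latSpan b G := by
  rw [eq_comm, Submodule.mkQ_apply, Submodule.mkQ_apply, Submodule.Quotient.eq]

section Slide

variable {G : Finset (Fin n)} {i : Fin n} (a : Fin n → ℕ)

theorem zonoPts_subset_succ (hi : i ∉ G) :
    zonoPts b G a ⊆ zonoPts b G (Function.update a i (a i + 1)) := fun x hx =>
  (mem_zono_succ hi a _).2 ⟨0, le_rfl, zero_le_one, by rw [zero_smul, sub_zero]; exact hx⟩

theorem injOn_factor_slide (hi : i ∉ G) :
    Set.InjOn (Submodule.factor (latSpan_mono (b := b) (Finset.subset_insert i G)))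
      ((latSpan b G).mkQ '' (zonoPts b G (Function.update a i (a i + 1)) \ zonoPts b G a)) := by
  rintro _ ⟨x, ⟨hx, hx'⟩, rfl⟩ _ ⟨y, ⟨hy, hy'⟩, rfl⟩ hxy
  change (latSpan b (insert i G)).mkQ x = (latSpan b (insert i G)).mkQ y at hxy
  rw [mkQ_latSpan_eq_iff] at hxy ⊢
  rw [latSpan, Finset.coe_insert, Set.image_insert_eq, Submodule.mem_span_insert] at hxy
  obtain ⟨k, z, hz, hyx⟩ := hxy
  obtain ⟨σ, hσ0, hσ1, hσ⟩ := (mem_zono_succ hi a _).1 hx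
  obtain ⟨τ, hτ0, hτ1, hτ⟩ := (mem_zono_succ hi a _).1 hy
  have hy_eq : y = x + k • b i + z := by rw [add_assoc, ← hyx, add_sub_cancel]
  have hk : (0 : ℤ) = k := by
    refine int_eq_of_notMem_of_ordConnected (ordConnected_line (b := b) G a (toR d x) (toR d (b i)))
      ?_ ?_ ⟨σ, hσ0, hσ1, ?_⟩ ⟨τ, hτ0, hτ1, ?_⟩
    · change ¬ toR d x + ((0 : ℤ) : ℝ) • toR d (b i) ∈ zono b G a
      rw [Int.cast_zero, zero_smul, add_zero]
      exact hx'
    · intro hk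
      change toR d x + (k : ℝ) • toR d (b i) ∈ zono b G a at hk
      rw [← toR_smul, ← toR_add] at hk
      exact hy' (zonoPts_of_sub_mem (x := x + k • b i) hk (by
        rw [hy_eq, add_sub_cancel_left]; exact hz))
    · simpa [sub_eq_add_neg] using hσ
    · have := zono_add_mem_span hτ (Submodule.neg_mem _ (toR_mem_spanF (b := b) hz))
      rw [hy_eq, toR_add, toR_add, toR_smul] at this
      change toR d x + ((k : ℝ) - τ) • toR d (b i) ∈ zono b G a
      convert this using 1
      module
  rw [hyx, ← hk, zero_smul, zero_add]
  exact hz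

theorem image_factor_slide (hi : i ∉ G) (hspan : toR d (b i) ∉ spanF d n b G) :
    Submodule.factor (latSpan_mono (b := b) (Finset.subset_insert i G)) ''
      ((latSpan b G).mkQ '' (zonoPts b G (Function.update a i (a i + 1)) \ zonoPts b G a)) =
      zonoCosets b (insert i G) a := by
  rw [Set.image_image]
  apply Set.Subset.antisymm
  · rintro _ ⟨x, ⟨hx, -⟩, rfl⟩
    obtain ⟨τ, -, -, hτ⟩ := (mem_zono_succ hi a _).1 hx
    exact ⟨x, (mem_zono_insert a _).2 ⟨-τ, by simpa [sub_eq_add_neg] using hτ⟩, rfl⟩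
  · rintro _ ⟨x, hx, rfl⟩
    obtain ⟨k, hk, τ, h0, h1, hτ⟩ := exists_int_notMem_of_bddAbove
      ((mem_zono_insert a _).1 hx) (bddAbove_line hspan a (toR d x))
    change ¬ toR d x + (k : ℝ) • toR d (b i) ∈ zono b G a at hk
    change toR d x + ((k : ℝ) - τ) • toR d (b i) ∈ zono b G a at hτ
    refine ⟨x + k • b i, ⟨(mem_zono_succ hi a _).2 ⟨τ, h0, h1, ?_⟩, fun h => hk ?_⟩, ?_⟩
    · rw [toR_add, toR_smul, add_sub_assoc, ← sub_smul]
      exact hτ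
    · rw [← toR_smul, ← toR_add]
      exact h
    · change (latSpan b (insert i G)).mkQ (x + k • b i) = (latSpan b (insert i G)).mkQ x
      rw [eq_comm, mkQ_latSpan_eq_iff, add_sub_cancel_left]
      exact Submodule.smul_mem _ _ (Submodule.subset_span ⟨i, by simp, rfl⟩)

theorem zonoCosets_succ_eq_union (hi : i ∉ G) :
    zonoCosets b G (Function.update a i (a i + 1)) = zonoCosets b G a ∪
      (latSpan b G).mkQ '' (zonoPts b G (Function.update a i (a i + 1)) \ zonoPts b G a) := by
  rw [zonoCosets, zonoCosets, ← Set.image_union, Set.union_sdiff_self,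
    Set.union_eq_right.2 (zonoPts_subset_succ a hi)]

theorem disjoint_zonoCosets_slide :
    Disjoint (zonoCosets b G a)
      ((latSpan b G).mkQ '' (zonoPts b G (Function.update a i (a i + 1)) \ zonoPts b G a)) := by
  rw [Set.disjoint_left]
  rintro _ ⟨x, hx, rfl⟩ ⟨y, ⟨-, hy⟩, hxy⟩
  exact hy (zonoPts_of_sub_mem hx (mkQ_latSpan_eq_iff.1 hxy.symm))

theorem zonoCosets_succ_finite (hi : i ∉ G) (hspan : toR d (b i) ∉ spanF d n b G)
    (h1 : (zonoCosets b G a).Finite) (h2 : (zonoCosets b (insert i G) a).Finite) :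
    (zonoCosets b G (Function.update a i (a i + 1))).Finite := by
  rw [zonoCosets_succ_eq_union a hi]
  refine h1.union (Set.Finite.of_finite_image ?_ (injOn_factor_slide a hi))
  rwa [image_factor_slide a hi hspan]

theorem zonoCosets_succ_ncard (hi : i ∉ G) (hspan : toR d (b i) ∉ spanF d n b G)
    (h1 : (zonoCosets b G a).Finite) (h2 : (zonoCosets b (insert i G) a).Finite) :
    (zonoCosets b G (Function.update a i (a i + 1))).ncard =
      (zonoCosets b G a).ncard + (zonoCosets b (insert i G) a).ncard := by
  have hfin := zonoCosets_succ_finite a hi hspan h1 h2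
  rw [zonoCosets_succ_eq_union a hi] at hfin ⊢
  rw [Set.ncard_union_eq (disjoint_zonoCosets_slide a) h1 (hfin.subset Set.subset_union_right),
    ← image_factor_slide a hi hspan, (injOn_factor_slide a hi).ncard_image]

end Slide

/-- The lattice points of the half-open parallelepiped spanned by the `b i`, `i ∈ F`. -/
def halfOpenPts (b : Fin n → Fin d → ℤ) (F : Finset (Fin n)) : Set (Fin d → ℤ) :=
  {x | ∃ c : Fin n → ℝ, (∀ i ∈ F, 0 ≤ c i ∧ c i < 1) ∧ toR d x = ∑ i ∈ F, c i • toR d (b i)}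

theorem halfOpenPts_finite (F : Finset (Fin n)) : (halfOpenPts b F).Finite := by
  refine (Set.finite_Icc (fun j => -∑ i ∈ F, |b i j|) fun j => ∑ i ∈ F, |b i j|).subset ?_
  rintro x ⟨c, hc, hx⟩
  have key : ∀ j, |x j| ≤ ∑ i ∈ F, |b i j| := fun j => by
    have hj := congrFun hx j
    simp only [Finset.sum_apply, Pi.smul_apply, smul_eq_mul, toR] at hj
    have : |(x j : ℝ)| ≤ ∑ i ∈ F, |(b i j : ℝ)| := by
      rw [hj]
      refine (Finset.abs_sum_le_sum_abs _ _).trans (Finset.sum_le_sum fun i hi => ?_)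
      rw [abs_mul, abs_of_nonneg (hc i hi).1]
      exact mul_le_of_le_one_left (abs_nonneg _) (hc i hi).2.le
    exact_mod_cast this
  exact ⟨fun j => (abs_le.1 (key j)).1, fun j => (abs_le.1 (key j)).2⟩

theorem memMatroid.eq_of_sum_eq {F : Finset (Fin n)} (hF : memMatroid d n b F)
    {c c' : Fin n → ℝ}
    (h : ∑ i ∈ F, c i • toR d (b i) = ∑ i ∈ F, c' i • toR d (b i)) : ∀ i ∈ F, c i = c' i := by
  have hF' : LinearIndepOn ℝ (fun i => toR d (b i)) (F : Set (Fin n)) := hF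
  rw [linearIndepOn_finset_iff] at hF'
  intro i hi
  refine sub_eq_zero.1 (hF' (fun i => c i - c' i) ?_ i hi)
  simp only [sub_smul, Finset.sum_sub_distrib, h, sub_self]

theorem memMatroid.mono {F G : Finset (Fin n)} (hF : memMatroid d n b F) (hGF : G ⊆ F) :
    memMatroid d n b G :=
  LinearIndepOn.mono (R := ℝ) (v := fun i => toR d (b i)) (s := (F : Set (Fin n))) hF
    (Finset.coe_subset.2 hGF)

theorem bijOn_mkQ_halfOpenPts {F : Finset (Fin n)} (hF : memMatroid d n b F) :
    Set.BijOn (latSpan b F).mkQ (halfOpenPts b F) (zonoCosets b F 0) := by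
  refine ⟨?_, ?_, ?_⟩
  · rintro x ⟨c, hc, hx⟩
    refine ⟨x, ⟨fun i => if i ∈ F then c i else 0, fun i hi => by simp [hi], ?_⟩, rfl⟩
    rw [hx]
    simp [ite_smul]
  · rintro x ⟨c, hc, hx⟩ y ⟨c', hc', hy⟩ hxy
    obtain ⟨k, hk, hyx⟩ := exists_coeff_of_mem_latSpan (mkQ_latSpan_eq_iff.1 hxy)
    have hsum : ∑ i, k i • b i = ∑ i ∈ F, k i • b i :=
      (Finset.sum_subset (Finset.subset_univ F) fun i _ hi => by simp [hk i hi]).symm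
    rw [hsum] at hyx
    have hyx' : y = x + ∑ i ∈ F, k i • b i := by rw [← hyx, add_sub_cancel]
    have h0 : ∀ i ∈ F, k i = 0 := fun i hi => by
      have heq := hF.eq_of_sum_eq (c := c') (c' := fun i => c i + k i) (by
        rw [← hy, hyx', toR_add, toR_sum, hx, ← Finset.sum_add_distrib]
        simp only [toR_smul, add_smul]) i hi
      have h1 := hc i hi
      have h2 := hc' i hi
      have h3 : (k i : ℝ) < ((1 : ℤ) : ℝ) := by push_cast; linarith
      have h4 : ((-1 : ℤ) : ℝ) < (k i : ℝ) := by push_cast; linarith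
      have h3' : k i < 1 := by exact_mod_cast h3
      have h4' : -1 < k i := by exact_mod_cast h4
      omega
    rw [hyx', Finset.sum_eq_zero fun i hi => by rw [h0 i hi, zero_smul], add_zero]
  · rintro _ ⟨x, ⟨c, hc, hx⟩, rfl⟩
    have hc0 : ∀ i, i ∉ F → c i = 0 := fun i hi => by
      have := hc i hi
      simp only [Pi.zero_apply, Nat.cast_zero] at this
      exact le_antisymm this.2 this.1
    have hx' : toR d x = ∑ i ∈ F, c i • toR d (b i) := by
      rw [hx]
      exact (Finset.sum_subset (Finset.subset_univ F) fun i _ hi => by simp [hc0 i hi]).symm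
    refine ⟨x + ∑ i ∈ F, (-⌊c i⌋) • b i, ⟨fun i => Int.fract (c i),
      fun i _ => ⟨Int.fract_nonneg _, Int.fract_lt_one _⟩, ?_⟩, ?_⟩
    · rw [toR_add, toR_sum, hx', ← Finset.sum_add_distrib]
      refine Finset.sum_congr rfl fun i _ => ?_
      change _ = Int.fract (c i) • _
      rw [toR_smul, ← add_smul, ← Int.self_sub_floor, Int.cast_neg, sub_eq_add_neg]
    · rw [eq_comm, mkQ_latSpan_eq_iff, add_sub_cancel_left]
      exact Submodule.sum_mem _ fun i hi =>
        Submodule.smul_mem _ _ (Submodule.subset_span ⟨i, hi, rfl⟩)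

theorem halfOpenPts_eq_biUnion_box (F : Finset (Fin n)) :
    halfOpenPts b F = ⋃ G ∈ F.powerset, {z | toR d z ∈ box d n b G} := by
  ext x
  simp only [Set.mem_iUnion, exists_prop, Finset.mem_powerset]
  constructor
  · rintro ⟨c, hc, hx⟩
    refine ⟨F.filter fun i => c i ≠ 0, Finset.filter_subset _ _, c, fun i hi => ?_, ?_⟩
    · rw [Finset.mem_filter] at hi
      exact ⟨lt_of_le_of_ne (hc i hi.1).1 hi.2.symm, (hc i hi.1).2⟩
    · rw [hx, Finset.sum_filter_of_ne]
      intro i _ h h0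
      exact h (by rw [h0, zero_smul])
  · rintro ⟨G, hGF, c, hc, hx⟩
    refine ⟨fun i => if i ∈ G then c i else 0, fun i _ => ?_, ?_⟩
    · by_cases hi : i ∈ G
      · simpa [hi] using ⟨(hc i hi).1.le, (hc i hi).2⟩
      · simp [hi]
    · rw [hx]
      simp only [ite_smul, zero_smul, Finset.sum_ite_mem, Finset.inter_eq_right.2 hGF]

theorem disjoint_box {F G G' : Finset (Fin n)} (hF : memMatroid d n b F) (hG : G ⊆ F)
    (hG' : G' ⊆ F) (hne : G ≠ G') :
    Disjoint {z | toR d z ∈ box d n b G} {z | toR d z ∈ box d n b G'} := by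
  rw [Set.disjoint_left]
  rintro x ⟨c, hc, hx⟩ ⟨c', hc', hx'⟩
  have hcc := hF.eq_of_sum_eq (c := fun i => if i ∈ G then c i else 0)
    (c' := fun i => if i ∈ G' then c' i else 0) (by
      simp only [ite_smul, zero_smul, Finset.sum_ite_mem, Finset.inter_eq_right.2 hG,
        Finset.inter_eq_right.2 hG']
      rw [← hx, hx'])
  refine hne (Finset.ext fun i => ⟨fun hi => ?_, fun hi => ?_⟩)
  · by_contra h
    have := hcc i (hG hi)
    simp only [hi, h, if_true, if_false] at this
    exact (hc i hi).1.ne' this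
  · by_contra h
    have := hcc i (hG' hi)
    simp only [hi, h, if_true, if_false] at this
    exact (hc' i hi).1.ne this

theorem zonoCosets_zero_finite {F : Finset (Fin n)} (hF : memMatroid d n b F) :
    (zonoCosets b F 0).Finite := by
  rw [← (bijOn_mkQ_halfOpenPts hF).image_eq]
  exact (halfOpenPts_finite F).image _

theorem zonoCosets_zero_ncard {F : Finset (Fin n)} (hF : memMatroid d n b F) :
    (zonoCosets b F 0).ncard = ∑ G ∈ F.powerset, boxCount d n b G := by
  have hfin := halfOpenPts_finite (b := b) F
  rw [← (bijOn_mkQ_halfOpenPts hF).image_eq, (bijOn_mkQ_halfOpenPts hF).injOn.ncard_image]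
  rw [halfOpenPts_eq_biUnion_box] at hfin ⊢
  rw [ncard_biUnion_finset]
  · rfl
  · exact fun G hG => hfin.subset (Set.subset_biUnion_of_mem (u := fun G =>
      {z | toR d z ∈ box d n b G}) hG)
  · exact fun G hG G' hG' => disjoint_box hF (Finset.mem_powerset.1 hG) (Finset.mem_powerset.1 hG')

/-- The number of lattice points, up to lattice translation, in the zonotope `zono b G a`. -/
theorem zonoCosets_finite_and_ncard (a : Fin n → ℕ) {G : Finset (Fin n)}
    (hG : memMatroid d n b G) :
    (zonoCosets b G a).Finite ∧ (zonoCosets b G a).ncard =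
      ∑ F, if G ⊆ F ∧ memMatroid d n b F then
        (zonoCosets b F 0).ncard * ∏ j ∈ F \ G, a j else 0 := by
  induction hs : ∑ j, a j generalizing a G with
  | zero =>
    obtain rfl : a = 0 := funext fun j => by
      simpa using (Finset.sum_eq_zero_iff.1 hs) j (Finset.mem_univ j)
    refine ⟨zonoCosets_zero_finite hG, ?_⟩
    rw [Finset.sum_eq_single G]
    · simp [hG]
    · intro F _ hFG
      split_ifs with h
      · obtain ⟨j, hj, hj'⟩ := Finset.exists_of_ssubset (lt_of_le_of_ne h.1 hFG.symm)
        rw [Finset.prod_eq_zero (Finset.mem_sdiff.2 ⟨hj, hj'⟩) rfl, mul_zero]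
      · rfl
    · simp
  | succ s ih =>
    obtain ⟨i, -, hi0⟩ := Finset.exists_ne_zero_of_sum_ne_zero (hs.trans_ne s.succ_ne_zero)
    obtain ⟨a, rfl⟩ : ∃ a' : Fin n → ℕ, a = Function.update a' i (a' i + 1) :=
      ⟨Function.update a i (a i - 1), by
        simp [Nat.sub_add_cancel (Nat.one_le_iff_ne_zero.2 hi0)]⟩
    replace hs : ∑ j, a j = s := by
      rw [Finset.sum_update_of_mem (Finset.mem_univ i)] at hs
      rw [← Finset.add_sum_erase _ a (Finset.mem_univ i), Finset.erase_eq]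
      omega
    have hprod : ∀ F : Finset (Fin n), i ∉ F \ G →
        ∏ j ∈ F \ G, Function.update a i (a i + 1) j = ∏ j ∈ F \ G, a j := fun F hF =>
      Finset.prod_congr rfl fun j hj => Function.update_of_ne (by rintro rfl; exact hF hj) _ _
    by_cases hiG : i ∈ G
    · have heq : zonoCosets b G (Function.update a i (a i + 1)) = zonoCosets b G a := by
        simp only [zonoCosets, zonoPts, zono_update_of_mem hiG]
      rw [heq]
      simpa only [hprod _ fun h => (Finset.mem_sdiff.1 h).2 hiG] using ih a hG hs
    by_cases hspan : toR d (b i) ∈ spanF d n b G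
    · have heq : zonoCosets b G (Function.update a i (a i + 1)) = zonoCosets b G a := by
        simp only [zonoCosets, zonoPts, zono_succ_of_mem_span hiG hspan]
      rw [heq]
      refine ⟨(ih a hG hs).1, (ih a hG hs).2.trans (Finset.sum_congr rfl fun F _ => ?_)⟩
      split_ifs with h
      · rw [hprod]
        intro hi
        have hiF := Finset.insert_subset (Finset.mem_sdiff.1 hi).1 h.1
        have hins : LinearIndepOn ℝ (fun i => toR d (b i)) (insert i (G : Set (Fin n))) := by
          rw [← Finset.coe_insert]
          exact h.2.mono hiF
        exact hins.notMem_span_of_insert hiG hspan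
      · rfl
    · have hG' : memMatroid d n b (insert i G) := by
        have hG1 : LinearIndepOn ℝ (fun i => toR d (b i)) (G : Set (Fin n)) := hG
        have := hG1.insert hspan
        rwa [← Finset.coe_insert] at this
      obtain ⟨h1, h1'⟩ := ih a hG hs
      obtain ⟨h2, h2'⟩ := ih a hG' hs
      refine ⟨zonoCosets_succ_finite a hiG hspan h1 h2, ?_⟩
      rw [zonoCosets_succ_ncard a hiG hspan h1 h2, h1', h2', ← Finset.sum_add_distrib]
      refine Finset.sum_congr rfl fun F _ => ?_
      by_cases hiF : i ∈ F
      · by_cases h : G ⊆ F ∧ memMatroid d n b F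
        · have hi : i ∈ F \ G := Finset.mem_sdiff.2 ⟨hiF, hiG⟩
          have he : F \ insert i G = (F \ G).erase i := by
            ext j; simp only [Finset.mem_sdiff, Finset.mem_insert, Finset.mem_erase]; tauto
          rw [if_pos h, if_pos h, if_pos ⟨Finset.insert_subset hiF h.1, h.2⟩, he,
            ← Finset.mul_prod_erase _ _ hi, ← Finset.mul_prod_erase _ _ hi, Function.update_self,
            Finset.prod_congr rfl fun j hj =>
              Function.update_of_ne (Finset.ne_of_mem_erase hj) (a i + 1) a]
          ring
        · have h' : ¬ (insert i G ⊆ F ∧ memMatroid d n b F) := fun h' =>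
            h ⟨(Finset.subset_insert _ _).trans h'.1, h'.2⟩
          rw [if_neg h, if_neg h, if_neg h']
      · have h' : ¬ (insert i G ⊆ F ∧ memMatroid d n b F) := fun h' =>
          hiF (h'.1 (Finset.mem_insert_self _ _))
        rw [if_neg h', add_zero, hprod F fun h => hiF (Finset.mem_sdiff.1 h).1]


theorem zonoPts_empty_finite_and_ncard (a : Fin n → ℕ) :
    (zonoPts b ∅ a).Finite ∧ (zonoPts b ∅ a).ncard = ∑ F, if memMatroid d n b F then
      (∑ G ∈ F.powerset, boxCount d n b G) * ∏ j ∈ F, a j else 0 := by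
  have h0 : memMatroid d n b ∅ := linearIndependent_empty_type
  have hinj : Function.Injective (latSpan b ∅).mkQ := by
    rw [← LinearMap.ker_eq_bot, Submodule.ker_mkQ, latSpan, Finset.coe_empty, Set.image_empty,
      Submodule.span_empty]
  obtain ⟨h1, h2⟩ := zonoCosets_finite_and_ncard a h0
  refine ⟨h1.of_finite_image hinj.injOn, ?_⟩
  rw [zonoCosets, Set.ncard_image_of_injective _ hinj] at h2
  rw [h2]
  refine Finset.sum_congr rfl fun F _ => ?_
  by_cases hF : memMatroid d n b F
  · simp [hF, zonoCosets_zero_ncard hF]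
  · simp [hF]

/-! ### Lattice points of the Lawrence polytope -/

theorem mem_smul_lawrencePolytope (hn : 0 < n) (m : ℕ) (x : Fin d → ℝ) (y : Fin n → ℝ) :
    (x, y) ∈ (m : ℝ) • lawrencePolytope d n b ↔ (∑ i, y i = m) ∧
      ∃ c : Fin n → ℝ, (∀ i, 0 ≤ c i ∧ c i ≤ y i) ∧ x = ∑ i, c i • toR d (b i) := by
  constructor
  · suffices h : lawrencePolytope d n b ⊆ {p | (∑ i, p.2 i = 1) ∧
        ∃ c : Fin n → ℝ, (∀ i, 0 ≤ c i ∧ c i ≤ p.2 i) ∧ p.1 = ∑ i, c i • toR d (b i)} by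
      rintro ⟨⟨p, q⟩, hp, hpq⟩
      obtain ⟨hsum, c, hc, hx⟩ := h hp
      simp only at hsum hc hx
      simp only [Prod.smul_mk, Prod.mk.injEq] at hpq
      obtain ⟨rfl, rfl⟩ := hpq
      refine ⟨by simp [← Finset.mul_sum, hsum], fun i => m * c i, fun i => ?_, ?_⟩
      · exact ⟨mul_nonneg (Nat.cast_nonneg m) (hc i).1,
          mul_le_mul_of_nonneg_left (hc i).2 (Nat.cast_nonneg m)⟩
      · rw [hx, Finset.smul_sum]
        simp only [mul_smul]
    refine convexHull_min ?_ ?_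
    · rintro _ (⟨i, rfl⟩ | ⟨i, rfl⟩)
      · refine ⟨by simp [e], e n i, fun j => ⟨?_, le_rfl⟩, ?_⟩
        · by_cases h : j = i
          · subst h; simp [e]
          · simp [e, h]
        · simp [e, Pi.single_apply, ite_smul]
      · refine ⟨by simp [e], 0, fun j => ⟨le_rfl, ?_⟩, by simp⟩
        by_cases h : j = i
        · subst h; simp [e]
        · simp [e, h]
    · rintro ⟨p, q⟩ ⟨h1, c, hc, hp⟩ ⟨p', q'⟩ ⟨h1', c', hc', hp'⟩ s t hs ht hst
      simp only at h1 hc hp h1' hc' hp'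
      refine ⟨?_, fun i => s * c i + t * c' i, fun i => ⟨?_, ?_⟩, ?_⟩
      · simp [Finset.sum_add_distrib, ← Finset.mul_sum, h1, h1', hst]
      · have := (hc i).1
        have := (hc' i).1
        positivity
      · simp only [Prod.smul_mk, Prod.mk_add_mk, Pi.add_apply, Pi.smul_apply, smul_eq_mul]
        have := (hc i).2
        have := (hc' i).2
        gcongr
      · simp only [Prod.smul_mk, Prod.mk_add_mk, hp, hp', Finset.smul_sum, add_smul, mul_smul,
          Finset.sum_add_distrib]
  · rintro ⟨hsum, c, hc, hx⟩
    rcases Nat.eq_zero_or_pos m with rfl | hm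
    · have hy0 : ∀ i, y i = 0 := by
        have := (Finset.sum_eq_zero_iff_of_nonneg fun i _ => (hc i).1.trans (hc i).2).1
          (hsum.trans Nat.cast_zero)
        exact fun i => this i (Finset.mem_univ i)
      have hc0 : ∀ i, c i = 0 := fun i => le_antisymm ((hc i).2.trans (hy0 i).le) (hc i).1
      have hmem : ((0 : Fin d → ℝ), e n ⟨0, hn⟩) ∈ lawrencePolytope d n b :=
        subset_convexHull _ _ (Or.inr ⟨⟨0, hn⟩, rfl⟩)
      refine ⟨_, hmem, ?_⟩
      rw [hx]
      ext i <;> simp [hy0, hc0]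
    · have hm' : (m : ℝ) ≠ 0 := by positivity
      let w : Fin n ⊕ Fin n → ℝ := Sum.elim (fun i => c i / m) fun i => (y i - c i) / m
      let z : Fin n ⊕ Fin n → (Fin d → ℝ) × (Fin n → ℝ) :=
        Sum.elim (fun i => (toR d (b i), e n i)) fun i => (0, e n i)
      refine ⟨∑ k, w k • z k, (convex_convexHull ℝ _).sum_mem ?_ ?_ ?_, ?_⟩
      · rintro (i | i) -
        · exact div_nonneg (hc i).1 (Nat.cast_nonneg m)
        · exact div_nonneg (sub_nonneg.2 (hc i).2) (Nat.cast_nonneg m)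
      · rw [Fintype.sum_sum_type]
        simp only [w, Sum.elim_inl, Sum.elim_inr]
        rw [← Finset.sum_add_distrib]
        simp only [← add_div, add_sub_cancel]
        rw [← Finset.sum_div, hsum, div_self hm']
      · rintro (i | i) -
        · exact subset_convexHull _ _ (Or.inl ⟨i, rfl⟩)
        · exact subset_convexHull _ _ (Or.inr ⟨i, rfl⟩)
      · rw [Fintype.sum_sum_type]
        simp only [w, z, Sum.elim_inl, Sum.elim_inr, Prod.smul_mk, smul_zero, smul_add,
          Finset.smul_sum, smul_smul, mul_div_cancel₀ _ hm']
        refine Prod.ext ?_ ?_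
        · simp [Prod.fst_sum, hx]
        · ext j
          simp [Prod.snd_sum, e, Finset.sum_apply, Pi.single_apply]

theorem latticeCount_lawrencePolytope (hn : 0 < n) (m : ℕ) :
    latticeCount d n (lawrencePolytope d n b) m =
      ∑ a ∈ Finset.univ.piAntidiag m, (zonoPts b ∅ a).ncard := by
  have hset : {z : (Fin d → ℤ) × (Fin n → ℤ) |
      (toR d z.1, fun j => (z.2 j : ℝ)) ∈ (m : ℝ) • lawrencePolytope d n b} =
      ⋃ a ∈ Finset.univ.piAntidiag m,
        (fun x : Fin d → ℤ => (x, fun i : Fin n => (a i : ℤ))) '' zonoPts b ∅ a := by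
    ext ⟨x, y⟩
    simp only [Set.mem_iUnion, exists_prop, Finset.mem_piAntidiag, Finset.mem_univ, implies_true,
      and_true]
    change (toR d x, fun j => (y j : ℝ)) ∈ (m : ℝ) • lawrencePolytope d n b ↔ _
    rw [mem_smul_lawrencePolytope hn]
    constructor
    · rintro ⟨hsum, c, hc, hx⟩
      have hy : ∀ i, ((y i).toNat : ℤ) = y i := fun i => Int.toNat_of_nonneg (by
        exact_mod_cast (hc i).1.trans (hc i).2)
      have hyR : ∀ i, ((y i).toNat : ℝ) = y i := fun i => by exact_mod_cast congrArg Int.cast (hy i)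
      refine ⟨fun i => (y i).toNat, ?_, x, ⟨c, fun i _ => ⟨(hc i).1, ?_⟩, hx⟩, ?_⟩
      · have : ((∑ i, (y i).toNat : ℕ) : ℝ) = m := by
          rw [← hsum, Nat.cast_sum]
          exact Finset.sum_congr rfl fun i _ => hyR i
        exact_mod_cast this
      · rw [hyR]; exact (hc i).2
      · simp only [hy]
    · rintro ⟨a, ha, x', ⟨c, hc, hx⟩, hxy⟩
      simp only [Prod.mk.injEq] at hxy
      obtain ⟨rfl, rfl⟩ := hxy
      refine ⟨?_, c, fun i => ?_, hx⟩
      · rw [← ha]; push_cast; rfl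
      · simpa using hc i (by simp)
  have hinj : ∀ a : Fin n → ℕ, Function.Injective
      fun x : Fin d → ℤ => (x, fun i : Fin n => (a i : ℤ)) := fun a x y h => (Prod.mk.inj h).1
  rw [latticeCount, hset, Nat.card_coe_set_eq, ncard_biUnion_finset]
  · exact Finset.sum_congr rfl fun a _ => Set.ncard_image_of_injective _ (hinj a)
  · exact fun a _ => (zonoPts_empty_finite_and_ncard a).1.image _
  · intro a _ a' _ hne
    rw [Set.disjoint_left]
    rintro _ ⟨x, -, rfl⟩ ⟨x', -, h⟩
    refine hne (funext fun i => ?_)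
    have := congrFun (Prod.mk.inj h).2 i
    exact_mod_cast this.symm


theorem sum_piAntidiag_prod_eq_coeff (f : Fin n → ℕ → ℤ) (m : ℕ) :
    ∑ a ∈ (Finset.univ : Finset (Fin n)).piAntidiag m, ∏ i, f i (a i) =
      PowerSeries.coeff m (∏ i, PowerSeries.mk (f i)) := by
  rw [PowerSeries.coeff_prod]
  symm
  refine Finset.sum_nbij' (fun l => ⇑l) (fun a => Finsupp.equivFunOnFinite.symm a) ?_ ?_ ?_ ?_ ?_
  · intro l hl
    rw [Finset.mem_finsuppAntidiag] at hl
    simpa using hl.1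
  · intro a ha
    rw [Finset.mem_piAntidiag] at ha
    rw [Finset.mem_finsuppAntidiag]
    exact ⟨ha.1, Finset.subset_univ _⟩
  · intro l _
    ext; rfl
  · intro a _
    rfl
  · intro l _
    simp

theorem one_sub_X_mul_mk_one :
    (1 - PowerSeries.X) * PowerSeries.mk (fun _ => (1 : ℤ)) = 1 := by
  rw [mul_comm]
  exact PowerSeries.mk_one_mul_one_sub_eq_one ℤ

theorem one_sub_X_sq_mul_mk_id :
    (1 - PowerSeries.X) * ((1 - PowerSeries.X) * PowerSeries.mk (fun k => (k : ℤ))) =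
      PowerSeries.X := by
  have h : (1 - PowerSeries.X) * PowerSeries.mk (fun k => (k : ℤ)) =
      PowerSeries.X * PowerSeries.mk (fun _ => (1 : ℤ)) := by
    ext (_ | k)
    · simp [sub_mul]
    · simp [sub_mul, PowerSeries.coeff_succ_X_mul]
  rw [h, mul_left_comm, one_sub_X_mul_mk_one, mul_one]

theorem one_sub_X_pow_mul_prod (r : ℕ) (F : Finset (Fin n)) (hF : F.card ≤ r) :
    (1 - PowerSeries.X) ^ (n + r) *
      ∏ i, PowerSeries.mk (fun k => if i ∈ F then (k : ℤ) else 1) =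
      PowerSeries.X ^ F.card * (1 - PowerSeries.X) ^ (r - F.card) := by
  have h1 : (1 - PowerSeries.X : PowerSeries ℤ) ^ n *
      ∏ i : Fin n, PowerSeries.mk (fun k => if i ∈ F then (k : ℤ) else 1) =
      ((1 - PowerSeries.X) * PowerSeries.mk (fun k => (k : ℤ))) ^ F.card := by
    have h2 : (1 - PowerSeries.X : PowerSeries ℤ) ^ n =
        ∏ _i : Fin n, (1 - PowerSeries.X : PowerSeries ℤ) := by simp
    rw [h2, ← Finset.prod_mul_distrib, ← Finset.prod_const, ← Finset.filter_univ_mem F,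
      Finset.prod_filter]
    refine Finset.prod_congr rfl fun i _ => ?_
    by_cases hi : i ∈ F
    · simp only [Finset.filter_univ_mem, hi, if_true]
    · simp only [Finset.filter_univ_mem, hi, if_false, one_sub_X_mul_mk_one]
  obtain ⟨k, rfl⟩ := Nat.exists_eq_add_of_le hF
  rw [add_comm n, pow_add, mul_assoc, h1, pow_add, Nat.add_sub_cancel_left, mul_right_comm,
    ← mul_pow, one_sub_X_sq_mul_mk_id]

theorem memMatroid.card_le {F : Finset (Fin n)} (hF : memMatroid d n b F) : F.card ≤ d := by
  simpa using LinearIndependent.fintype_card_le_finrank hF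

theorem mk_latticeCount (hn : 0 < n) :
    PowerSeries.mk (fun m => (latticeCount d n (lawrencePolytope d n b) m : ℤ)) =
      ∑ F, if memMatroid d n b F then PowerSeries.C (∑ G ∈ F.powerset, (boxCount d n b G : ℤ)) *
        ∏ i, PowerSeries.mk (fun k => if i ∈ F then (k : ℤ) else 1) else 0 := by
  ext m
  rw [PowerSeries.coeff_mk, latticeCount_lawrencePolytope hn, map_sum, Nat.cast_sum]
  simp only [(zonoPts_empty_finite_and_ncard _).2, Nat.cast_sum]
  rw [Finset.sum_comm]
  refine Finset.sum_congr rfl fun F _ => ?_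
  split_ifs with hF
  · rw [PowerSeries.coeff_C_mul, ← sum_piAntidiag_prod_eq_coeff, Finset.mul_sum]
    refine Finset.sum_congr rfl fun a _ => ?_
    rw [Finset.prod_ite_mem, Finset.univ_inter]
    push_cast
    rfl
  · simp

/-- The Ehrhart `δ`-polynomial of the Lawrence polytope in terms of the independent sets. -/
theorem IsDeltaPoly.eq_sum (hn : 0 < n) {δ : ℤ[X]}
    (hδ : IsDeltaPoly d n (lawrencePolytope d n b) δ) :
    δ = ∑ F, if memMatroid d n b F then C (∑ G ∈ F.powerset, (boxCount d n b G : ℤ)) *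
      (X ^ F.card * (1 - X) ^ (d - F.card)) else 0 := by
  rw [← Polynomial.coe_inj, ← hδ.2, mk_latticeCount hn, Finset.mul_sum,
    ← Polynomial.coeToPowerSeries.ringHom_apply, map_sum]
  refine Finset.sum_congr rfl fun F _ => ?_
  split_ifs with hF
  · rw [mul_left_comm, one_sub_X_pow_mul_prod d F hF.card_le]
    have hC (z : ℤ) : PowerSeries.C z = ((C z : ℤ[X]) : PowerSeries ℤ) :=
      (Polynomial.coe_C z).symm
    rw [hC]
    simp
  · simp

theorem finrank_span_mkQ_sdiff
    (hspan : Submodule.span ℝ (Set.range fun i => toR d (b i)) = ⊤) {G : Finset (Fin n)}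
    (hG : memMatroid d n b G) :
    G.card + Module.finrank ℝ (Submodule.span ℝ
      (((spanF d n b G).mkQ ∘ fun i => toR d (b i)) '' (Finset.univ \ G : Finset (Fin n)))) = d := by
  have hrank := finrank_span_mkQ_add_card (K := ℝ) (b := fun i => toR d (b i))
    (Finset.disjoint_sdiff (s := G) (t := Finset.univ)) hG
  have hunion : (G : Set (Fin n)) ∪ ((Finset.univ \ G : Finset (Fin n)) : Set (Fin n)) =
      Set.univ := by
    ext i
    simp
  rw [hunion, Set.image_univ, hspan, finrank_top, Module.finrank_fin_fun] at hrank
  exact hrank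

/-- The `δ`-polynomial as a sum of shifted `h`-polynomials of the contractions of the matroid. -/
theorem IsDeltaPoly.eq_sum_configHPoly (hn : 0 < n)
    (hspan : Submodule.span ℝ (Set.range fun i => toR d (b i)) = ⊤) {δ : ℤ[X]}
    (hδ : IsDeltaPoly d n (lawrencePolytope d n b) δ) :
    δ = ∑ G ∈ Finset.univ.filter (memMatroid d n b), C (boxCount d n b G : ℤ) * (X ^ G.card *
      configHPoly ℝ ((spanF d n b G).mkQ ∘ fun i => toR d (b i)) (Finset.univ \ G)) := by
  rw [hδ.eq_sum hn]
  have h1 : ∀ F : Finset (Fin n), (if memMatroid d n b F then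
      C (∑ G ∈ F.powerset, (boxCount d n b G : ℤ)) * (X ^ F.card * (1 - X) ^ (d - F.card)) else 0) =
      ∑ G, if G ⊆ F ∧ memMatroid d n b F then
        C (boxCount d n b G : ℤ) * (X ^ F.card * (1 - X) ^ (d - F.card)) else 0 := fun F => by
    split_ifs with hF
    · simp only [hF, and_true]
      rw [map_sum, Finset.sum_mul, ← Finset.sum_filter]
      refine Finset.sum_congr ?_ fun _ _ => rfl
      ext G
      simp
    · simp [hF]
  simp only [h1]
  rw [Finset.sum_comm, Finset.sum_filter]
  refine Finset.sum_congr rfl fun G _ => ?_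
  split_ifs with hG
  swap
  · exact Finset.sum_eq_zero fun F _ => if_neg fun h => hG (h.2.mono h.1)
  have hG' : LinearIndepOn ℝ (fun i => toR d (b i)) (G : Set (Fin n)) := hG
  have hrank := finrank_span_mkQ_sdiff hspan hG
  rw [← Finset.sum_filter, configHPoly, Finset.mul_sum, Finset.mul_sum]
  have hdisj : ∀ {H : Finset (Fin n)}, H ∈ (Finset.univ \ G).powerset → Disjoint G H :=
    fun hH => Finset.disjoint_sdiff.mono_right (Finset.mem_powerset.1 hH)
  have hiff : ∀ H : Finset (Fin n), Disjoint G H → (memMatroid d n b (G ∪ H) ↔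
      LinearIndepOn ℝ ((spanF d n b G).mkQ ∘ fun i => toR d (b i)) (H : Set (Fin n))) :=
    fun H hH => by
      have := hG'.quotient_iff_union (Finset.disjoint_coe.2 hH)
      rw [← Finset.coe_union] at this
      exact this.symm
  refine Finset.sum_nbij' (fun F => F \ G) (fun H => G ∪ H) ?_ ?_ ?_ ?_ ?_
  · intro F hF
    obtain ⟨-, hGF, hF⟩ := Finset.mem_filter.1 hF
    refine Finset.mem_filter.2 ⟨Finset.mem_powerset.2 (Finset.sdiff_subset_sdiff
      (Finset.subset_univ F) subset_rfl), (hiff _ Finset.disjoint_sdiff).1 ?_⟩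
    rwa [Finset.union_sdiff_of_subset hGF]
  · intro H hH
    obtain ⟨hH, hHi⟩ := Finset.mem_filter.1 hH
    exact Finset.mem_filter.2 ⟨Finset.mem_univ _, Finset.subset_union_left,
      (hiff _ (hdisj hH)).2 hHi⟩
  · intro F hF
    exact Finset.union_sdiff_of_subset (Finset.mem_filter.1 hF).2.1
  · intro H hH
    exact Finset.union_sdiff_cancel_left (hdisj (Finset.mem_filter.1 hH).1)
  · intro F hF
    have hcard : (F \ G).card + G.card = F.card :=
      Finset.card_sdiff_add_card_eq_card (Finset.mem_filter.1 hF).2.1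
    rw [← mul_assoc (X ^ G.card), ← pow_add, add_comm G.card, hcard]
    rw [show d - F.card = Module.finrank ℝ (Submodule.span ℝ (((spanF d n b G).mkQ ∘
      fun i => toR d (b i)) '' (Finset.univ \ G : Finset (Fin n)))) - (F \ G).card by omega]

/-! ### Coefficient inequalities -/

theorem span_range_toR (hgen : Submodule.span ℤ (Set.range b) = ⊤) :
    Submodule.span ℝ (Set.range fun i => toR d (b i)) = ⊤ := by
  rw [eq_top_iff, ← (Pi.basisFun ℝ (Fin d)).span_eq, Submodule.span_le]
  rintro _ ⟨j, rfl⟩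
  have hj : (Pi.single j 1 : Fin d → ℤ) ∈ latSpan b Finset.univ := by
    rw [latSpan, Finset.coe_univ, Set.image_univ, hgen]
    trivial
  have := toR_mem_spanF hj
  rw [spanF, Finset.coe_univ, Set.image_univ] at this
  have heq : Pi.basisFun ℝ (Fin d) j = toR d (Pi.single j 1) := by
    ext k
    simp [toR, Pi.single_apply]
  rw [heq]
  exact this

theorem mem_span_compl_of_coloopFree (hcl : ColoopFree d n b) (i : Fin n) :
    toR d (b i) ∈ Submodule.span ℝ ((fun i => toR d (b i)) '' {i}ᶜ) := by
  obtain ⟨F, ⟨hF, hmax⟩, hiF⟩ := hcl i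
  have hF' : LinearIndepOn ℝ (fun i => toR d (b i)) (F : Set (Fin n)) := hF
  by_contra h
  have hspan : toR d (b i) ∉ Submodule.span ℝ ((fun i => toR d (b i)) '' F) := fun h' =>
    h (Submodule.span_mono (Set.image_mono (by rintro j hj rfl; exact hiF hj)) h')
  have hins := hF'.insert hspan
  rw [← Finset.coe_insert] at hins
  have := hmax (insert i F) hins (Finset.subset_insert _ _)
  exact hiF (this ▸ Finset.mem_insert_self i F)

theorem isTopHeavy_deltaPoly (hn : 0 < n) (hgen : Submodule.span ℤ (Set.range b) = ⊤)
    (hcl : ColoopFree d n b) {δ : ℤ[X]} (hδ : IsDeltaPoly d n (lawrencePolytope d n b) δ) :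
    IsTopHeavy d δ := by
  have hspan := span_range_toR hgen
  rw [hδ.eq_sum_configHPoly hn hspan]
  refine IsTopHeavy.sum _ _ fun G hG => ?_
  have hG' : memMatroid d n b G := (Finset.mem_filter.1 hG).2
  have hrank := finrank_span_mkQ_sdiff hspan hG'
  refine IsTopHeavy.natCast_mul ?_ _
  have hE : ∀ i ∈ Finset.univ \ G, ((spanF d n b G).mkQ ∘ fun i => toR d (b i)) i ∈
      Submodule.span ℝ (((spanF d n b G).mkQ ∘ fun i => toR d (b i)) ''
        (((Finset.univ \ G : Finset (Fin n)) : Set (Fin n)) \ {i})) := fun i _ => by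
    refine mem_span_mkQ_image G (Submodule.span_mono (Set.image_mono fun j hj => ?_)
      (mem_span_compl_of_coloopFree hcl i))
    by_cases hjG : j ∈ G
    · exact Or.inl hjG
    · exact Or.inr ⟨by simpa using hjG, hj⟩
  have htop := (isTopHeavy_configHPoly _ _ hE).X_pow_mul G.card
  rwa [add_comm, hrank] at htop

end Zonotope

/-- if `M_B` is coloop free then `δ_i ≤ δ_j` for `i ≤ j ≤ d - i`. -/
theorem statement6 (d n : ℕ) (hd : 0 < d) (hn : 0 < n)
    (b : Fin n → Fin d → ℤ) (hb : ∀ i, b i ≠ 0)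
    (hgen : Submodule.span ℤ (Set.range b) = ⊤)
    (hcl : ColoopFree d n b)
    (δ : Polynomial ℤ) (hδ : IsDeltaPoly d n (lawrencePolytope d n b) δ) :
    ∀ i j : ℕ, i ≤ j → j ≤ d - i → δ.coeff i ≤ δ.coeff j := by
  intro i j hij hj
  exact (isTopHeavy_deltaPoly hn hgen hcl hδ).2 i j hij (by omega)

end LawrencePaper
end
end

section
/- Suppose the real numbers r_1, …, r_n are chosen so that the hyperplane arrangement H is simple. Then the h-vector of the matroid M_B equals the h-vector of the complex of bounded cells of H; that is, Σ_{i=0}^{d} f_i t^i (1−t)^{d−i} = Σ_{i=0}^{d} f^bd_i (t−1)^i as polynomials, where f_i is the number of elements of M_B whose span has dimension i and f^bd_i is the number of bounded cells of H of dimension i. -/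
open scoped BigOperators Pointwise
open Polynomial

noncomputable section

namespace LawrencePaper

attribute [local instance] Classical.propDecidable

/-- The functionals `φ i` with `P i` take prescribed values simultaneously; over a field this
says that they are linearly independent. -/
def Interpolates {ι V : Type*} [AddCommGroup V] [Module ℝ V] (φ : ι → V →ₗ[ℝ] ℝ)
    (P : ι → Prop) : Prop :=
  ∀ y : ι → ℝ, ∃ v, ∀ i, P i → φ i v = y i

/-- The number `a` is allowed as the `i`-th coordinate of a recession direction of a cell whose
`i`-th sign is `ε`. -/
def SignCompat (ε : SignType) (a : ℝ) : Prop :=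
  (ε = 0 → a = 0) ∧ 0 ≤ (ε : ℝ) * a

/-- The cell with sign vector `σ` is nonempty and has no recession directions. -/
def BddCell {ι V : Type*} [AddCommGroup V] [Module ℝ V] (φ : ι → V →ₗ[ℝ] ℝ) (r : ι → ℝ)
    (σ : ι → SignType) : Prop :=
  (∃ x, ∀ i, SignType.sign (φ i x - r i) = σ i) ∧
    ∀ v, (∀ i, SignCompat (σ i) (φ i v)) → v = 0

/-- The number of zero coordinates of a sign vector. -/
def zeroCount {ι : Type*} [Fintype ι] (σ : ι → SignType) : ℕ :=
  (Finset.univ.filter fun i => σ i = 0).card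

/-- The size of the set with indicator `F`. -/
def trueCount {ι : Type*} [Fintype ι] (F : ι → Bool) : ℕ :=
  (Finset.univ.filter fun i => F i = true).card

/-- The generating polynomial of the bounded cells of an arrangement. -/
def bddPoly {n : ℕ} {V : Type*} [AddCommGroup V] [Module ℝ V] (φ : Fin n → V →ₗ[ℝ] ℝ)
    (r : Fin n → ℝ) : ℤ[X] :=
  ∑ σ : Fin n → SignType,
    if BddCell φ r σ then (X - 1) ^ (Module.finrank ℝ V - zeroCount σ) else 0

/-- The generating polynomial of the independent sets of a configuration of functionals. -/
def indepPoly {n : ℕ} {V : Type*} [AddCommGroup V] [Module ℝ V]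
    (φ : Fin n → V →ₗ[ℝ] ℝ) : ℤ[X] :=
  ∑ F : Fin n → Bool, if Interpolates φ (fun i => F i = true)
    then X ^ trueCount F * (1 - X) ^ (Module.finrank ℝ V - trueCount F) else 0

section SignCompat

lemma signCompat_zero {a : ℝ} : SignCompat 0 a ↔ a = 0 := by
  simp [SignCompat]

lemma signCompat_one {a : ℝ} : SignCompat 1 a ↔ 0 ≤ a := by
  simp [SignCompat]

lemma signCompat_neg_one {a : ℝ} : SignCompat (-1) a ↔ a ≤ 0 := by
  simp [SignCompat]

lemma SignCompat.of_zero (ε : SignType) : SignCompat ε 0 := by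
  simp [SignCompat]

lemma SignCompat.combo {ε : SignType} {a b s t : ℝ} (ha : SignCompat ε a) (hb : SignCompat ε b)
    (hs : 0 ≤ s) (ht : 0 ≤ t) : SignCompat ε (s * a + t * b) := by
  refine ⟨fun h => by rw [ha.1 h, hb.1 h]; ring, ?_⟩
  have h1 := mul_nonneg hs ha.2
  have h2 := mul_nonneg ht hb.2
  linarith

lemma SignCompat.eq_zero {ε : SignType} {a c : ℝ} (ha : SignCompat ε a) (hc : c < 0)
    (hb : SignCompat ε (c * a)) : a = 0 := by
  rcases SignType.trichotomy ε with rfl | rfl | rfl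
  · rw [signCompat_neg_one] at ha hb
    nlinarith
  · exact signCompat_zero.1 ha
  · rw [signCompat_one] at ha hb
    nlinarith

lemma sign_convex_combo {ε : SignType} {a b t : ℝ} (ha : SignType.sign a = ε)
    (hb : SignType.sign b = ε) (h0 : 0 < t) (h1 : t < 1) :
    SignType.sign ((1 - t) * a + t * b) = ε := by
  have h1' : 0 < 1 - t := by linarith
  rcases SignType.trichotomy ε with rfl | rfl | rfl
  · rw [sign_eq_neg_one_iff] at *
    nlinarith
  · rw [sign_eq_zero_iff] at *
    simp [ha, hb]
  · rw [sign_eq_one_iff] at *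
    positivity

lemma sign_add_of_signCompat {ε : SignType} {a c : ℝ} (ha : SignType.sign a = ε)
    (hc : SignCompat ε c) : SignType.sign (a + c) = ε := by
  rcases SignType.trichotomy ε with rfl | rfl | rfl
  · rw [signCompat_neg_one] at hc
    rw [sign_eq_neg_one_iff] at *
    linarith
  · rw [signCompat_zero] at hc
    rw [hc, add_zero, ha]
  · rw [signCompat_one] at hc
    rw [sign_eq_one_iff] at *
    linarith

end SignCompat

section Arrangement

variable {V : Type*} [AddCommGroup V] [Module ℝ V]

/-- Moving slightly in a direction of the linear span of a cell does not leave the cell. -/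
lemma eventually_sign_add_smul {ι : Type*} [Finite ι] (φ : ι → V →ₗ[ℝ] ℝ) (r : ι → ℝ) (x v : V)
    (h : ∀ i, φ i x = r i → φ i v = 0) :
    ∀ᶠ t in nhds (0 : ℝ), ∀ i,
      SignType.sign (φ i (x + t • v) - r i) = SignType.sign (φ i x - r i) := by
  rw [Filter.eventually_all]
  intro i
  have hc : Filter.Tendsto (fun t : ℝ => φ i (x + t • v) - r i) (nhds 0)
      (nhds (φ i x - r i)) := by
    have : Continuous fun t : ℝ => φ i x + t * φ i v - r i := by fun_prop
    simpa using this.tendsto 0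
  rcases lt_trichotomy (φ i x - r i) 0 with h0 | h0 | h0
  · filter_upwards [hc.eventually_lt_const h0] with t ht
    rw [sign_neg ht, sign_neg h0]
  · refine Filter.Eventually.of_forall fun t => ?_
    simp [h i (sub_eq_zero.1 h0)]
  · filter_upwards [hc.eventually_const_lt h0] with t ht
    rw [sign_pos ht, sign_pos h0]

/-- A cell meeting both open sides of a hyperplane meets the hyperplane. -/
lemma exists_mem_cell_of_lt_of_gt {ι : Type*} {φ : ι → V →ₗ[ℝ] ℝ} {r : ι → ℝ}
    {σ : ι → SignType} {ψ : V →ₗ[ℝ] ℝ} {ρ : ℝ} {x y : V}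
    (hx : ∀ i, SignType.sign (φ i x - r i) = σ i) (hy : ∀ i, SignType.sign (φ i y - r i) = σ i)
    (hψx : ψ x < ρ) (hψy : ρ < ψ y) :
    ∃ z, ψ z = ρ ∧ ∀ i, SignType.sign (φ i z - r i) = σ i := by
  have hd : 0 < ψ y - ψ x := by linarith
  set t := (ρ - ψ x) / (ψ y - ψ x) with ht
  have h0 : 0 < t := div_pos (by linarith) hd
  have h1 : t < 1 := by rw [ht, div_lt_one hd]; linarith
  refine ⟨(1 - t) • x + t • y, ?_, fun i => ?_⟩
  · have : t * (ψ y - ψ x) = ρ - ψ x := div_mul_cancel₀ _ hd.ne'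
    simp only [map_add, map_smul, smul_eq_mul]
    linarith
  · convert sign_convex_combo (hx i) (hy i) h0 h1 using 2
    simp only [map_add, map_smul, smul_eq_mul]
    ring

/-- The part of a cell on the side `ε` of a further hyperplane is nonempty and has no
recession directions. -/
def BddPart {ι : Type*} (φ : ι → V →ₗ[ℝ] ℝ) (r : ι → ℝ) (σ : ι → SignType) (ψ : V →ₗ[ℝ] ℝ)
    (ρ : ℝ) (ε : SignType) : Prop :=
  (∃ x, SignType.sign (ψ x - ρ) = ε ∧ ∀ i, SignType.sign (φ i x - r i) = σ i) ∧
    ∀ v, SignCompat ε (ψ v) → (∀ i, SignCompat (σ i) (φ i v)) → v = 0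

lemma bddCell_cons {n : ℕ} (φ : Fin (n + 1) → V →ₗ[ℝ] ℝ) (r : Fin (n + 1) → ℝ) (ε : SignType)
    (τ : Fin n → SignType) :
    BddCell φ r (Fin.cons ε τ : Fin (n + 1) → SignType) ↔
      BddPart (fun i => φ i.succ) (fun i => r i.succ) τ (φ 0) (r 0) ε := by
  simp [BddCell, BddPart, Fin.forall_fin_succ]

section Count

variable {ι : Type*} {φ : ι → V →ₗ[ℝ] ℝ} {r : ι → ℝ} {σ : ι → SignType} {ψ : V →ₗ[ℝ] ℝ} {ρ : ℝ}

lemma BddCell.bddPart (h : BddCell φ r σ) {ε : SignType} {x : V}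
    (hx : SignType.sign (ψ x - ρ) = ε) (hxσ : ∀ i, SignType.sign (φ i x - r i) = σ i) :
    BddPart φ r σ ψ ρ ε :=
  ⟨⟨x, hx, hxσ⟩, fun v _ hv => h.2 v hv⟩

/-- If a cell misses a hyperplane and its part on one side of it is nonempty without recession
directions, then so is the cell. -/
lemma bddCell_of_bddPart_of_side (h0 : ¬∃ z, ψ z = ρ ∧ ∀ i, SignType.sign (φ i z - r i) = σ i) :
    (BddPart φ r σ ψ ρ 1 ∨ BddPart φ r σ ψ ρ (-1)) → BddCell φ r σ := by
  rintro (⟨⟨x, hx, hxσ⟩, hv⟩ | ⟨⟨x, hx, hxσ⟩, hv⟩) <;> refine ⟨⟨x, hxσ⟩, fun v hvσ => hv v ?_ hvσ⟩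
  · rw [sign_eq_one_iff, sub_pos] at hx
    rw [signCompat_one]
    by_contra! hneg
    obtain ⟨t, ht0, ht⟩ : ∃ t : ℝ, 0 ≤ t ∧ ψ x + t * ψ v = ρ - 1 :=
      ⟨(ρ - 1 - ψ x) / ψ v, div_nonneg_of_nonpos (by linarith) hneg.le,
        by rw [div_mul_cancel₀ _ hneg.ne]; ring⟩
    refine h0 (exists_mem_cell_of_lt_of_gt (x := x + t • v) (fun i => ?_) hxσ ?_ hx)
    · convert sign_add_of_signCompat (hxσ i)
        (by simpa using (hvσ i).combo (SignCompat.of_zero _) ht0 le_rfl) using 2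
      simp only [map_add, map_smul, smul_eq_mul]
      ring
    · simp only [map_add, map_smul, smul_eq_mul]
      linarith
  · rw [sign_eq_neg_one_iff, sub_neg] at hx
    rw [signCompat_neg_one]
    by_contra! hpos
    obtain ⟨t, ht0, ht⟩ : ∃ t : ℝ, 0 ≤ t ∧ ψ x + t * ψ v = ρ + 1 :=
      ⟨(ρ + 1 - ψ x) / ψ v, div_nonneg (by linarith) hpos.le,
        by rw [div_mul_cancel₀ _ hpos.ne']; ring⟩
    refine h0 (exists_mem_cell_of_lt_of_gt (y := x + t • v) hxσ (fun i => ?_) hx ?_)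
    · convert sign_add_of_signCompat (hxσ i)
        (by simpa using (hvσ i).combo (SignCompat.of_zero _) ht0 le_rfl) using 2
      simp only [map_add, map_smul, smul_eq_mul]
      ring
    · simp only [map_add, map_smul, smul_eq_mul]
      linarith

/-- A pointed unbounded cell whose hyperplane section is bounded has a recession direction on
at most one side of the hyperplane. -/
lemma eq_zero_or_eq_zero_of_section (hess : ∀ v, (∀ i, φ i v = 0) → v = 0)
    (hsec : ∀ v, ψ v = 0 → (∀ i, SignCompat (σ i) (φ i v)) → v = 0) {u v : V}
    (hu : ψ u ≤ 0) (huσ : ∀ i, SignCompat (σ i) (φ i u))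
    (hv : 0 ≤ ψ v) (hvσ : ∀ i, SignCompat (σ i) (φ i v)) : u = 0 ∨ v = 0 := by
  by_contra! hne
  have hu' : ψ u < 0 := hu.lt_of_ne fun h => hne.1 (hsec u h huσ)
  have hv' : 0 < ψ v := hv.lt_of_ne fun h => hne.2 (hsec v h.symm hvσ)
  have hw : ψ v • u + (-ψ u) • v = 0 := by
    refine hsec _ (by simp [mul_comm]) fun i => ?_
    simpa using (huσ i).combo (hvσ i) hv'.le (neg_nonneg.2 hu)
  refine hne.1 (hess u fun i => ?_)
  have hi : ψ v * φ i u + (-ψ u) * φ i v = 0 := by simpa using congrArg (φ i) hw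
  refine (huσ i).eq_zero (c := ψ v / ψ u) (div_neg_of_pos_of_neg hv' hu') ?_
  convert hvσ i using 1
  rw [div_mul_eq_mul_div, div_eq_iff hu'.ne]
  linarith

lemma bddPart_count [Finite ι] (hess : ∀ v, (∀ i, φ i v = 0) → v = 0)
    (hs : ∀ x, ψ x = ρ → ∃ v, ψ v = 1 ∧ ∀ i, φ i x = r i → φ i v = 0) :
    ((if BddPart φ r σ ψ ρ 1 then 1 else 0) + (if BddPart φ r σ ψ ρ (-1) then 1 else 0) : ℕ) =
      (if BddCell φ r σ then 1 else 0) + (if BddPart φ r σ ψ ρ 0 then 1 else 0) := by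
  by_cases h0 : ∃ z, ψ z = ρ ∧ ∀ i, SignType.sign (φ i z - r i) = σ i
  · obtain ⟨x, hx, hxσ⟩ := h0
    obtain ⟨v, hv, hvx⟩ := hs x hx
    have hsides : (∃ x, SignType.sign (ψ x - ρ) = 1 ∧ ∀ i, SignType.sign (φ i x - r i) = σ i) ∧
        ∃ x, SignType.sign (ψ x - ρ) = -1 ∧ ∀ i, SignType.sign (φ i x - r i) = σ i := by
      have hev := eventually_sign_add_smul φ r x v hvx
      constructor
      · obtain ⟨t, ht, ht0⟩ := ((hev.filter_mono nhdsWithin_le_nhds).and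
          (self_mem_nhdsWithin (s := Set.Ioi (0 : ℝ)))).exists
        exact ⟨x + t • v, by simpa [hx, hv, sign_eq_one_iff] using ht0,
          fun i => (ht i).trans (hxσ i)⟩
      · obtain ⟨t, ht, ht0⟩ := ((hev.filter_mono nhdsWithin_le_nhds).and
          (self_mem_nhdsWithin (s := Set.Iio (0 : ℝ)))).exists
        exact ⟨x + t • v, by simpa [hx, hv, sign_eq_neg_one_iff] using ht0,
          fun i => (ht i).trans (hxσ i)⟩
    obtain ⟨⟨xp, hxp, hxpσ⟩, xn, hxn, hxnσ⟩ := hsides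
    have hx0 : SignType.sign (ψ x - ρ) = 0 := by simp [hx]
    by_cases hC : BddCell φ r σ
    · rw [if_pos hC, if_pos (hC.bddPart hxp hxpσ), if_pos (hC.bddPart hxn hxnσ),
        if_pos (hC.bddPart hx0 hxσ)]
    obtain ⟨w, hwσ, hw⟩ : ∃ w, (∀ i, SignCompat (σ i) (φ i w)) ∧ w ≠ 0 := by
      by_contra! h
      exact hC ⟨⟨x, hxσ⟩, h⟩
    by_cases hZ : BddPart φ r σ ψ ρ 0
    · rw [if_neg hC, if_pos hZ]
      have hsec : ∀ v, ψ v = 0 → (∀ i, SignCompat (σ i) (φ i v)) → v = 0 := fun v h =>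
        hZ.2 v (signCompat_zero.2 h)
      rcases le_total (ψ w) 0 with hle | hle
      · rw [if_pos, if_neg]
        · exact fun h => hw (h.2 w (signCompat_neg_one.2 hle) hwσ)
        · exact ⟨⟨xp, hxp, hxpσ⟩, fun u hu huσ =>
            (eq_zero_or_eq_zero_of_section hess hsec hle hwσ (signCompat_one.1 hu)
              huσ).resolve_left hw⟩
      · rw [if_neg, if_pos]
        · exact ⟨⟨xn, hxn, hxnσ⟩, fun u hu huσ =>
            (eq_zero_or_eq_zero_of_section hess hsec (signCompat_neg_one.1 hu) huσ hle
              hwσ).resolve_right hw⟩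
        · exact fun h => hw (h.2 w (signCompat_one.2 hle) hwσ)
    · obtain ⟨u, hu0, huσ, hu⟩ :
          ∃ u, ψ u = 0 ∧ (∀ i, SignCompat (σ i) (φ i u)) ∧ u ≠ 0 := by
        by_contra! h
        exact hZ ⟨⟨x, hx0, hxσ⟩, fun v h1 h2 => h v (signCompat_zero.1 h1) h2⟩
      rw [if_neg hC, if_neg hZ, if_neg, if_neg]
      · exact fun h => hu (h.2 u (by rw [hu0]; exact SignCompat.of_zero _) huσ)
      · exact fun h => hu (h.2 u (by rw [hu0]; exact SignCompat.of_zero _) huσ)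
  · have hZ : ¬BddPart φ r σ ψ ρ 0 := by
      rintro ⟨⟨x, hx, hxσ⟩, -⟩
      exact h0 ⟨x, sub_eq_zero.1 (sign_eq_zero_iff.1 hx), hxσ⟩
    have himp := bddCell_of_bddPart_of_side h0
    by_cases hC : BddCell φ r σ
    · obtain ⟨x, hxσ⟩ := hC.1
      rcases lt_trichotomy (ψ x) ρ with h | h | h
      · have hn : BddPart φ r σ ψ ρ (-1) :=
          hC.bddPart (sign_eq_neg_one_iff.2 (sub_neg.2 h)) hxσ
        have hp : ¬BddPart φ r σ ψ ρ 1 := by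
          rintro ⟨⟨y, hy, hyσ⟩, -⟩
          exact h0 (exists_mem_cell_of_lt_of_gt hxσ hyσ h (sub_pos.1 (sign_eq_one_iff.1 hy)))
        rw [if_pos hC, if_pos hn, if_neg hp, if_neg hZ]
      · exact absurd ⟨x, h, hxσ⟩ h0
      · have hp : BddPart φ r σ ψ ρ 1 := hC.bddPart (sign_eq_one_iff.2 (sub_pos.2 h)) hxσ
        have hn : ¬BddPart φ r σ ψ ρ (-1) := by
          rintro ⟨⟨y, hy, hyσ⟩, -⟩
          exact h0 (exists_mem_cell_of_lt_of_gt hyσ hxσ (sub_neg.1 (sign_eq_neg_one_iff.1 hy)) h)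
        rw [if_pos hC, if_neg hn, if_pos hp, if_neg hZ]
    · rw [if_neg hC, if_neg hZ, if_neg fun h => hC (himp (Or.inl h)),
        if_neg fun h => hC (himp (Or.inr h))]

end Count

section Directions

variable {ι : Type*} {φ : ι → V →ₗ[ℝ] ℝ} {P : ι → Prop}

/-- The common kernel of the functionals `φ i` with `P i`. -/
def commonKer (φ : ι → V →ₗ[ℝ] ℝ) (P : ι → Prop) : Submodule ℝ V :=
  LinearMap.ker (LinearMap.pi fun i : {i // P i} => φ i.1)

lemma mem_commonKer {v : V} : v ∈ commonKer φ P ↔ ∀ i, P i → φ i v = 0 := by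
  simp [commonKer, funext_iff]

variable [Fintype ι] [FiniteDimensional ℝ V]

lemma interpolates_iff_finrank [DecidablePred P] : Interpolates φ P ↔
    Module.finrank ℝ (commonKer φ P) + (Finset.univ.filter P).card = Module.finrank ℝ V := by
  set Φ : V →ₗ[ℝ] {i // P i} → ℝ := LinearMap.pi fun i => φ i.1 with hΦ
  have hsurj : Interpolates φ P ↔ LinearMap.range Φ = ⊤ := by
    rw [LinearMap.range_eq_top]
    constructor
    · intro h y
      obtain ⟨v, hv⟩ := h fun i => if hi : P i then y ⟨i, hi⟩ else 0
      exact ⟨v, funext fun i => by simp [hΦ, hv i.1 i.2, i.2]⟩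
    · intro h y
      obtain ⟨v, hv⟩ := h fun i => y i.1
      exact ⟨v, fun i hi => by simpa [hΦ] using congrFun hv ⟨i, hi⟩⟩
  have hrank := Φ.finrank_range_add_finrank_ker
  have htop : Module.finrank ℝ ({i // P i} → ℝ) = (Finset.univ.filter P).card := by
    rw [Module.finrank_fintype_fun_eq_card, Fintype.card_subtype]
  rw [hsurj, ← hrank, ← htop, commonKer, ← hΦ, add_comm, Nat.add_right_cancel_iff]
  exact ⟨fun h => by rw [h, finrank_top], fun h => Submodule.eq_top_of_finrank_eq h.symm⟩

/-- Interpolating functionals are at most as many as the dimension. -/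
lemma Interpolates.card_le [DecidablePred P] (h : Interpolates φ P) :
    (Finset.univ.filter P).card ≤ Module.finrank ℝ V := by
  have := interpolates_iff_finrank.1 h
  omega

end Directions

section Recursion

variable {n : ℕ}

lemma zeroCount_cons (ε : SignType) (τ : Fin n → SignType) :
    zeroCount (Fin.cons ε τ : Fin (n + 1) → SignType) = (if ε = 0 then 1 else 0) + zeroCount τ := by
  simp only [zeroCount, Fin.card_filter_univ_succ', Fin.cons_zero,
    Fin.cons_succ]

lemma trueCount_cons (a : Bool) (F : Fin n → Bool) :
    trueCount (Fin.cons a F : Fin (n + 1) → Bool) = (if a = true then 1 else 0) + trueCount F := by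
  simp only [trueCount, Fin.card_filter_univ_succ', Fin.cons_zero,
    Fin.cons_succ]

lemma bddPoly_succ (φ : Fin (n + 1) → V →ₗ[ℝ] ℝ) (r : Fin (n + 1) → ℝ) :
    bddPoly φ r = ∑ τ : Fin n → SignType,
      ((if BddPart (fun i => φ i.succ) (fun i => r i.succ) τ (φ 0) (r 0) 0 then
          (X - 1) ^ (Module.finrank ℝ V - 1 - zeroCount τ) else 0) +
        ((if BddPart (fun i => φ i.succ) (fun i => r i.succ) τ (φ 0) (r 0) (-1) then
          (X - 1) ^ (Module.finrank ℝ V - zeroCount τ) else 0) +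
        (if BddPart (fun i => φ i.succ) (fun i => r i.succ) τ (φ 0) (r 0) 1 then
          (X - 1) ^ (Module.finrank ℝ V - zeroCount τ) else 0))) := by
  rw [bddPoly, ← (Fin.consEquiv fun _ => SignType).sum_comp, Fintype.sum_prod_type,
    Finset.sum_comm]
  refine Finset.sum_congr rfl fun τ _ => ?_
  have h (ε : SignType) : (Fin.consEquiv fun _ => SignType) (ε, τ) =
      (Fin.cons ε τ : Fin (n + 1) → SignType) := rfl
  simp only [h, bddCell_cons, zeroCount_cons, ← Nat.sub_sub]
  have huniv : (Finset.univ : Finset SignType) = {0, -1, 1} := rfl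
  rw [huniv, Finset.sum_insert (by decide), Finset.sum_insert (by decide), Finset.sum_singleton]
  simp

/-- The functionals other than the first one, restricted to the kernel of the first one. -/
def contract (φ : Fin (n + 1) → V →ₗ[ℝ] ℝ) (i : Fin n) : LinearMap.ker (φ 0) →ₗ[ℝ] ℝ :=
  (φ i.succ).domRestrict (LinearMap.ker (φ 0))

@[simp]
lemma contract_apply (φ : Fin (n + 1) → V →ₗ[ℝ] ℝ) (i : Fin n) (x : LinearMap.ker (φ 0)) :
    contract φ i x = φ i.succ x := rfl

lemma interpolates_cons_false (φ : Fin (n + 1) → V →ₗ[ℝ] ℝ) (F : Fin n → Bool) :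
    Interpolates φ (fun i => (Fin.cons false F : Fin (n + 1) → Bool) i = true) ↔
      Interpolates (fun i : Fin n => φ i.succ) (fun i => F i = true) := by
  constructor
  · intro h y
    obtain ⟨v, hv⟩ := h (Fin.cons 0 y)
    exact ⟨v, fun i hi => by simpa using hv i.succ (by simpa using hi)⟩
  · intro h y
    obtain ⟨v, hv⟩ := h fun i => y i.succ
    exact ⟨v, fun i => by
      refine Fin.cases (fun h => by simp at h) (fun i hi => ?_) i
      exact hv i (by simpa using hi)⟩

lemma interpolates_cons_true {φ : Fin (n + 1) → V →ₗ[ℝ] ℝ} (hφ : φ 0 ≠ 0) (F : Fin n → Bool) :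
    Interpolates φ (fun i => (Fin.cons true F : Fin (n + 1) → Bool) i = true) ↔
      Interpolates (contract φ) (fun i => F i = true) := by
  constructor
  · intro h y
    obtain ⟨v, hv⟩ := h (Fin.cons 0 y)
    exact ⟨⟨v, by simpa using hv 0 (by simp)⟩, fun i hi => by
      simpa using hv i.succ (by simpa using hi)⟩
  · intro h y
    obtain ⟨u, hu⟩ := LinearMap.surjective hφ (y 0)
    obtain ⟨w, hw⟩ := h fun i => y i.succ - φ i.succ u
    refine ⟨u + w, fun i => ?_⟩
    refine Fin.cases (fun _ => ?_) (fun i hi => ?_) i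
    · simp [hu]
    · have := hw i (by simpa using hi)
      rw [contract_apply] at this
      rw [map_add, this]
      ring

lemma indepPoly_succ (φ : Fin (n + 1) → V →ₗ[ℝ] ℝ) :
    indepPoly φ = ∑ F : Fin n → Bool,
      ((if Interpolates φ (fun i => (Fin.cons true F : Fin (n + 1) → Bool) i = true) then
          X * (X ^ trueCount F * (1 - X) ^ (Module.finrank ℝ V - 1 - trueCount F)) else 0) +
        (if Interpolates (fun i : Fin n => φ i.succ) (fun i => F i = true) then
          X ^ trueCount F * (1 - X) ^ (Module.finrank ℝ V - trueCount F) else 0)) := by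
  rw [indepPoly, ← (Fin.consEquiv fun _ => Bool).sum_comp, Fintype.sum_prod_type,
    Finset.sum_comm]
  refine Finset.sum_congr rfl fun F _ => ?_
  have h (a : Bool) : (Fin.consEquiv fun _ => Bool) (a, F) =
      (Fin.cons a F : Fin (n + 1) → Bool) := rfl
  simp only [h, trueCount_cons, ← Nat.sub_sub, Fintype.sum_bool, interpolates_cons_false]
  simp [pow_add, mul_assoc]

lemma bddPart_zero_iff {φ : Fin (n + 1) → V →ₗ[ℝ] ℝ} {r : Fin (n + 1) → ℝ} {p : V}
    (hp : φ 0 p = r 0) (τ : Fin n → SignType) :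
    BddPart (fun i => φ i.succ) (fun i => r i.succ) τ (φ 0) (r 0) 0 ↔
      BddCell (contract φ) (fun i => r i.succ - φ i.succ p) τ := by
  refine and_congr ⟨?_, ?_⟩ ⟨?_, ?_⟩
  · rintro ⟨x, hx, hxτ⟩
    rw [sign_eq_zero_iff, sub_eq_zero] at hx
    refine ⟨⟨x - p, by simp [hx, hp]⟩, fun i => ?_⟩
    rw [← hxτ i]
    simp
  · rintro ⟨x, hx⟩
    have h0 : φ 0 x = 0 := x.2
    refine ⟨x + p, by simp [h0, hp], fun i => ?_⟩
    rw [← hx i]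
    simp [add_sub_assoc, sub_sub_eq_add_sub]
  · intro h v hv
    exact Subtype.ext (h v (signCompat_zero.2 v.2) hv)
  · intro h v hv0 hv
    exact congrArg Subtype.val (h ⟨v, signCompat_zero.1 hv0⟩ hv)

lemma Interpolates.contract_eq {φ : Fin (n + 1) → V →ₗ[ℝ] ℝ} {r : Fin (n + 1) → ℝ} {p : V}
    (hp : φ 0 p = r 0) (hs : ∀ x, Interpolates φ fun i => φ i x = r i)
    (x : LinearMap.ker (φ 0)) :
    Interpolates (contract φ) fun i => contract φ i x = r i.succ - φ i.succ p := by
  intro y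
  have h0 : φ 0 x = 0 := x.2
  obtain ⟨v, hv⟩ := hs (x + p) (Fin.cons 0 y)
  refine ⟨⟨v, by simpa using hv 0 (by simp [h0, hp])⟩, fun i hi => ?_⟩
  have hi' : φ i.succ x = r i.succ - φ i.succ p := hi
  simpa using hv i.succ (by simp [hi'])

end Recursion

/-- In a simple essential arrangement, the generating polynomial of the bounded cells is
determined by the independent sets of normal vectors. -/
theorem indepPoly_eq_bddPoly {n : ℕ} [FiniteDimensional ℝ V] (φ : Fin n → V →ₗ[ℝ] ℝ)
    (r : Fin n → ℝ) (hess : ∀ v, (∀ i, φ i v = 0) → v = 0)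
    (hs : ∀ x, Interpolates φ fun i => φ i x = r i) : indepPoly φ = bddPoly φ r := by
  induction n generalizing V with
  | zero =>
    have hV : ∀ v : V, v = 0 := fun v => hess v fun i => i.elim0
    have : Subsingleton V := ⟨fun a b => by rw [hV a, hV b]⟩
    have h1 (F : Fin 0 → Bool) : Interpolates φ fun i => F i = true :=
      fun _ => ⟨0, fun i => i.elim0⟩
    have h2 (σ : Fin 0 → SignType) : BddCell φ r σ := ⟨⟨0, fun i => i.elim0⟩, fun v _ => hV v⟩
    simp [indepPoly, bddPoly, h1, h2, trueCount, Module.finrank_zero_of_subsingleton]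
  | succ n ih =>
    have hs' (x : V) : Interpolates (fun i : Fin n => φ i.succ) fun i => φ i.succ x = r i.succ :=
      fun y => by
        obtain ⟨v, hv⟩ := hs x (Fin.cons 0 y)
        exact ⟨v, fun i hi => by simpa using hv i.succ hi⟩
    rw [indepPoly_succ, bddPoly_succ]
    by_cases hφ : φ 0 = 0
    · have hr : r 0 ≠ 0 := by
        intro hr
        obtain ⟨v, hv⟩ := hs 0 fun _ => 1
        have := hv 0 (by simp [hr])
        simp [hφ] at this
      have hess' (v : V) (hv : ∀ i : Fin n, φ i.succ v = 0) : v = 0 :=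
        hess v (Fin.cases (by simp [hφ]) hv)
      have hT (F : Fin n → Bool) :
          ¬Interpolates φ fun i => (Fin.cons true F : Fin (n + 1) → Bool) i = true := by
        intro h
        obtain ⟨v, hv⟩ := h fun _ => 1
        have := hv 0 (by simp)
        simp [hφ] at this
      have ih' := ih (fun i => φ i.succ) (fun i => r i.succ) hess' hs'
      simp only [hT, if_false, zero_add]
      rw [← indepPoly, ih', bddPoly]
      refine Finset.sum_congr rfl fun τ _ => ?_
      have hcount := bddPart_count (r := fun i => r i.succ) (σ := τ) (ψ := φ 0) (ρ := r 0) hess'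
        fun x hx => absurd (by simpa [hφ] using hx.symm) hr
      have h0 : ¬BddPart (fun i => φ i.succ) (fun i => r i.succ) τ (φ 0) (r 0) 0 := by
        rintro ⟨⟨x, hx, -⟩, -⟩
        simp [hφ, hr] at hx
      rw [if_neg h0] at hcount ⊢
      split_ifs at hcount ⊢ <;> first | omega | simp
    obtain ⟨p, hp⟩ := LinearMap.surjective hφ (r 0)
    have hdim : Module.finrank ℝ (LinearMap.ker (φ 0)) = Module.finrank ℝ V - 1 := by
      have := Module.Dual.finrank_ker_add_one_of_ne_zero hφ
      omega
    have ihc := ih (contract φ) (fun i => r i.succ - φ i.succ p)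
      (fun v hv => Subtype.ext (hess v (Fin.cases v.2 hv)))
      (Interpolates.contract_eq hp hs)
    rw [indepPoly, bddPoly, hdim] at ihc
    simp only [interpolates_cons_true hφ, bddPart_zero_iff hp]
    by_cases hess' : ∀ v, (∀ i : Fin n, φ i.succ v = 0) → v = 0
    · have ihd := ih (fun i => φ i.succ) (fun i => r i.succ) hess' hs'
      rw [indepPoly, bddPoly] at ihd
      rw [Finset.sum_add_distrib, ihd]
      have hX := congrArg (fun q : ℤ[X] => X * q) ihc
      simp only [Finset.mul_sum, mul_ite, mul_zero] at hX
      rw [hX, ← Finset.sum_add_distrib]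
      refine Finset.sum_congr rfl fun τ _ => ?_
      have hcount := bddPart_count (r := fun i => r i.succ) (σ := τ) (ψ := φ 0) (ρ := r 0) hess'
        fun x hx => by
          obtain ⟨v, hv⟩ := hs x (Fin.cons 1 0)
          exact ⟨v, by simpa using hv 0 hx, fun i hi => by simpa using hv i.succ hi⟩
      rw [if_congr (bddPart_zero_iff hp τ) rfl rfl] at hcount
      by_cases hc : BddCell (contract φ) (fun i => r i.succ - φ i.succ p) τ
      · have hz : zeroCount τ + 1 ≤ Module.finrank ℝ V := by
          obtain ⟨x, hx⟩ := hc.1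
          have h1 := (Interpolates.contract_eq hp hs x).card_le
          have h2 := Module.Dual.finrank_ker_add_one_of_ne_zero hφ
          have h3 : zeroCount τ = (Finset.univ.filter fun i =>
              contract φ i x = r i.succ - φ i.succ p).card := by
            simp only [zeroCount, ← hx, sign_eq_zero_iff, sub_eq_zero]
          omega
        obtain ⟨k, hk⟩ := Nat.exists_eq_add_of_le hz
        have e1 : Module.finrank ℝ V - 1 - zeroCount τ = k := by omega
        have e2 : Module.finrank ℝ V - zeroCount τ = k + 1 := by omega
        rw [e1, e2]
        split_ifs at hcount ⊢ <;> first | omega | ring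
      · rw [if_neg hc] at hcount ⊢
        split_ifs at hcount ⊢ <;> first | omega | simp
    · push Not at hess'
      obtain ⟨v, hv, hv0⟩ := hess'
      have hψv : φ 0 v ≠ 0 := fun h => hv0 (hess v (Fin.cases h hv))
      have hside (τ : Fin n → SignType) (ε : SignType) (hε : ε ≠ 0) :
          ¬BddPart (fun i => φ i.succ) (fun i => r i.succ) τ (φ 0) (r 0) ε := by
        rintro ⟨-, h⟩
        have h1 : ((ε : ℝ) * φ 0 v) • v = 0 := by
          refine h _ ⟨fun h => absurd h hε, ?_⟩ fun i => ?_
          · simp only [map_smul, smul_eq_mul]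
            nlinarith [mul_self_nonneg ((ε : ℝ) * φ 0 v)]
          · simp [hv, SignCompat.of_zero]
        rcases smul_eq_zero.1 h1 with h2 | h2
        · rcases mul_eq_zero.1 h2 with h3 | h3
          · rcases SignType.trichotomy ε with rfl | rfl | rfl <;> simp_all
          · exact hψv h3
        · exact hv0 h2
      have hcol (F : Fin n → Bool) : Interpolates (fun i : Fin n => φ i.succ) (fun i => F i = true) ↔
          Interpolates (contract φ) (fun i => F i = true) := by
        refine ⟨fun h y => ?_, fun h y => ?_⟩
        · obtain ⟨u, hu⟩ := h y
          refine ⟨⟨u - (φ 0 u / φ 0 v) • v, ?_⟩, fun i hi => ?_⟩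
          · simp [hψv]
          · simp [hv, hu i hi]
        · obtain ⟨u, hu⟩ := h y
          exact ⟨u, hu⟩
      simp only [hside _ 1 (by decide), hside _ (-1) (by decide), if_false, add_zero, hcol]
      rw [← ihc]
      refine Finset.sum_congr rfl fun F _ => ?_
      split_ifs with hF
      · have h1 : trueCount F ≤ Module.finrank ℝ (LinearMap.ker (φ 0)) := hF.card_le
        have h2 := Module.Dual.finrank_ker_add_one_of_ne_zero hφ
        obtain ⟨k, hk⟩ := Nat.exists_eq_add_of_le h1
        have e1 : Module.finrank ℝ V - 1 - trueCount F = k := by omega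
        have e2 : Module.finrank ℝ V - trueCount F = k + 1 := by omega
        rw [e1, e2]
        ring
      · simp

end Arrangement

section Cells

variable {n : ℕ}

/-- The set of points with sign vector `σ`. -/
def signCell {V : Type*} [AddCommGroup V] [Module ℝ V] (φ : Fin n → V →ₗ[ℝ] ℝ) (r : Fin n → ℝ)
    (σ : Fin n → SignType) : Set V :=
  {x | ∀ i, SignType.sign (φ i x - r i) = σ i}

lemma signCell_injOn {V : Type*} [AddCommGroup V] [Module ℝ V] (φ : Fin n → V →ₗ[ℝ] ℝ)
    (r : Fin n → ℝ) : Set.InjOn (signCell φ r) {σ | BddCell φ r σ} := by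
  rintro σ ⟨⟨x, hx⟩, -⟩ τ - h
  have hxτ : x ∈ signCell φ r τ := h ▸ hx
  exact funext fun i => (hx i).symm.trans (hxτ i)

lemma vectorSpan_signCell {V : Type*} [AddCommGroup V] [Module ℝ V] {φ : Fin n → V →ₗ[ℝ] ℝ}
    {r : Fin n → ℝ} {σ : Fin n → SignType} {x : V} (hx : x ∈ signCell φ r σ) :
    vectorSpan ℝ (signCell φ r σ) = commonKer φ fun i => φ i x = r i := by
  have hzero (y : V) (hy : y ∈ signCell φ r σ) (i : Fin n) (hi : φ i x = r i) : φ i y = r i := by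
    have : SignType.sign (φ i y - r i) = 0 := by rw [hy i, ← hx i, hi, sub_self, sign_zero]
    exact sub_eq_zero.1 (sign_eq_zero_iff.1 this)
  refine le_antisymm (Submodule.span_le.2 ?_) fun v hv => ?_
  · rintro _ ⟨y, hy, z, hz, rfl⟩
    refine mem_commonKer.2 fun i hi => ?_
    simp [hzero y hy i hi, hzero z hz i hi]
  · have hev := eventually_sign_add_smul φ r x v (mem_commonKer.1 hv)
    obtain ⟨t, ht, ht0⟩ := ((hev.filter_mono nhdsWithin_le_nhds).and
      (self_mem_nhdsWithin (s := Set.Ioi (0 : ℝ)))).exists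
    have hmem := vsub_mem_vectorSpan ℝ (s := signCell φ r σ) (fun i => (ht i).trans (hx i)) hx
    rw [vsub_eq_sub, add_sub_cancel_left] at hmem
    exact (Submodule.smul_mem_iff _ (ne_of_gt ht0)).1 hmem

lemma zeroCount_eq {V : Type*} [AddCommGroup V] [Module ℝ V] {φ : Fin n → V →ₗ[ℝ] ℝ}
    {r : Fin n → ℝ} {σ : Fin n → SignType} {x : V} (hx : x ∈ signCell φ r σ) :
    zeroCount σ = (Finset.univ.filter fun i => φ i x = r i).card := by
  have hx' : ∀ i, SignType.sign (φ i x - r i) = σ i := hx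
  simp only [zeroCount, ← hx', sign_eq_zero_iff, sub_eq_zero]

/-- The amount by which `a` fails to be compatible with the sign `ε`. -/
def violation (ε : SignType) (a : ℝ) : ℝ :=
  if ε = 0 then |a| else max 0 (-(ε * a))

lemma violation_nonneg (ε : SignType) (a : ℝ) : 0 ≤ violation ε a := by
  unfold violation
  split_ifs
  · exact abs_nonneg a
  · exact le_max_left _ _

lemma continuous_violation (ε : SignType) : Continuous (violation ε) := by
  unfold violation
  split_ifs <;> fun_prop

lemma signCompat_of_violation_eq_zero {ε : SignType} {a : ℝ} (h : violation ε a = 0) :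
    SignCompat ε a := by
  rcases SignType.trichotomy ε with rfl | rfl | rfl
  · simpa [signCompat_neg_one, violation] using h
  · simpa [signCompat_zero, violation] using h
  · simpa [signCompat_one, violation] using h

lemma violation_mul {ε : SignType} {a t : ℝ} (ht : 0 ≤ t) :
    violation ε (t * a) = t * violation ε a := by
  unfold violation
  split_ifs
  · rw [abs_mul, abs_of_nonneg ht]
  · rw [mul_max_of_nonneg _ _ ht, mul_zero]
    congr 1
    ring

lemma violation_le {ε : SignType} {a ρ : ℝ} (h : SignType.sign (a - ρ) = ε) :
    violation ε a ≤ |ρ| := by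
  rcases SignType.trichotomy ε with rfl | rfl | rfl
  · rw [sign_eq_neg_one_iff] at h
    simp only [violation, reduceCtorEq, if_false, SignType.coe_neg_one]
    exact max_le (abs_nonneg ρ) (by linarith [le_abs_self ρ])
  · rw [sign_eq_zero_iff, sub_eq_zero] at h
    simp [violation, h]
  · rw [sign_eq_one_iff] at h
    simp only [violation, reduceCtorEq, if_false, SignType.coe_one]
    exact max_le (abs_nonneg ρ) (by linarith [neg_abs_le ρ])

/-- A nonempty cell is bounded exactly when it has no recession directions. -/
lemma isBounded_signCell_iff {V : Type*} [NormedAddCommGroup V] [NormedSpace ℝ V]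
    [FiniteDimensional ℝ V] {φ : Fin n → V →ₗ[ℝ] ℝ} {r : Fin n → ℝ} {σ : Fin n → SignType}
    {x : V} (hx : x ∈ signCell φ r σ) :
    Bornology.IsBounded (signCell φ r σ) ↔ ∀ v, (∀ i, SignCompat (σ i) (φ i v)) → v = 0 := by
  constructor
  · intro hb v hv
    by_contra hv0
    obtain ⟨c, hc⟩ := hb.exists_norm_le
    have hvpos : 0 < ‖v‖ := norm_pos_iff.2 hv0
    have hc0 : 0 ≤ c := (norm_nonneg x).trans (hc x hx)
    set t := (c + ‖x‖ + 1) / ‖v‖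
    have ht : 0 ≤ t := by positivity
    have htv : ‖t • v‖ = c + ‖x‖ + 1 := by
      rw [norm_smul, Real.norm_of_nonneg ht, div_mul_cancel₀ _ hvpos.ne']
    have hmem : x + t • v ∈ signCell φ r σ := fun i => by
      convert sign_add_of_signCompat (hx i)
        (by simpa using (hv i).combo (SignCompat.of_zero _) ht le_rfl) using 2
      simp only [map_add, map_smul, smul_eq_mul]
      ring
    have h1 := hc _ hmem
    have h2 := norm_sub_le (x + t • v) x
    rw [add_sub_cancel_left] at h2
    linarith
  · intro hrec
    set g : V → ℝ := fun v => ∑ i, violation (σ i) (φ i v) with hg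
    have hcont : Continuous g := continuous_finsetSum _ fun i _ =>
      (continuous_violation _).comp (φ i).continuous_of_finiteDimensional
    have hpos (v : V) (hv : v ∈ Metric.sphere (0 : V) 1) : 0 < g v := by
      refine (Finset.sum_nonneg fun i _ => violation_nonneg _ _).lt_of_ne fun h => ?_
      have h0 := (Finset.sum_eq_zero_iff_of_nonneg fun i _ => violation_nonneg _ _).1 h.symm
      have := hrec v fun i => signCompat_of_violation_eq_zero (h0 i (Finset.mem_univ i))
      simp [this] at hv
    obtain ⟨c, hc, hcg⟩ := (isCompact_sphere (0 : V) 1).exists_forall_le' hcont.continuousOn hpos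
    refine isBounded_iff_forall_norm_le.2 ⟨(∑ i, |r i|) / c, fun y hy => ?_⟩
    rw [le_div_iff₀ hc]
    have hle : g y ≤ ∑ i, |r i| := Finset.sum_le_sum fun i _ => violation_le (hy i)
    refine le_trans ?_ hle
    rcases eq_or_ne y 0 with rfl | hy0
    · rw [norm_zero, zero_mul]
      exact Finset.sum_nonneg fun i _ => violation_nonneg _ _
    · have hn : 0 < ‖y‖ := norm_pos_iff.2 hy0
      have h1 := hcg (‖y‖⁻¹ • y) (by simp [norm_smul, hn.ne'])
      have h2 : g (‖y‖⁻¹ • y) = ‖y‖⁻¹ * g y := by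
        simp only [hg, map_smul, smul_eq_mul, violation_mul (inv_nonneg.2 hn.le), Finset.mul_sum]
      rw [h2, le_inv_mul_iff₀ hn] at h1
      exact h1

end Cells

lemma sum_ite_eq_sum_card {α : Type*} [Fintype α] (p : α → Prop) (k : α → ℕ) (m : ℕ)
    (hk : ∀ a, p a → k a ≤ m) (g : ℕ → ℤ[X]) :
    (∑ a, if p a then g (k a) else 0) =
      ∑ i ∈ Finset.range (m + 1), C (Nat.card {a | p a ∧ k a = i} : ℤ) * g i := by
  rw [← Finset.sum_filter, ← Finset.sum_fiberwise_of_maps_to (g := k) (t := Finset.range (m + 1))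
    fun a ha => Finset.mem_range_succ_iff.2 (hk a (Finset.mem_filter.1 ha).2)]
  refine Finset.sum_congr rfl fun i _ => ?_
  rw [Finset.filter_filter, Finset.sum_congr rfl fun a ha => by
    rw [(Finset.mem_filter.1 ha).2.2], Finset.sum_const]
  have : Nat.card {a | p a ∧ k a = i} =
      (Finset.univ.filter fun a => p a ∧ k a = i).card := by
    rw [Nat.card_coe_set_eq, Set.ncard_eq_toFinset_card', Set.toFinset_ofPred]
  rw [this]
  simp

section Configuration

variable {d n : ℕ} {b : Fin n → Fin d → ℤ} {r : Fin n → ℝ}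

/-- Pairing with the vector `b i`. -/
def pairing (b : Fin n → Fin d → ℤ) (i : Fin n) : (Fin d → ℝ) →ₗ[ℝ] ℝ :=
  ∑ j, (b i j : ℝ) • LinearMap.proj j

@[simp]
lemma pairing_apply (b : Fin n → Fin d → ℤ) (i : Fin n) (u : Fin d → ℝ) :
    pairing b i u = ∑ j, u j * (b i j : ℝ) := by
  simp [pairing, mul_comm]

lemma eq_zero_of_pairing_eq_zero (hgen : Submodule.span ℤ (Set.range b) = ⊤) (v : Fin d → ℝ)
    (hv : ∀ i, pairing b i v = 0) : v = 0 := by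
  set f : (Fin d → ℤ) →ₗ[ℤ] ℝ := ∑ j, (v j) • ((Int.castAddHom ℝ).toIntLinearMap ∘ₗ
    (LinearMap.proj j : (Fin d → ℤ) →ₗ[ℤ] ℤ)) with hf
  have hfa (z : Fin d → ℤ) : f z = ∑ j, v j * (z j : ℝ) := by simp [hf]
  have hker : LinearMap.ker f = ⊤ := by
    rw [eq_top_iff, ← hgen, Submodule.span_le]
    rintro _ ⟨i, rfl⟩
    have := hv i
    rw [pairing_apply] at this
    simpa [hfa] using this
  funext j
  have hj : f (Pi.single j 1) = 0 := by
    rw [← LinearMap.mem_ker, hker]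
    trivial
  rw [hfa, Finset.sum_eq_single j] at hj
  · simpa using hj
  · intro k _ hk
    simp [hk]
  · simp

lemma interpolates_of_simple (hr : Simple d n b r) (x : Fin d → ℝ) :
    Interpolates (pairing b) fun i => pairing b i x = r i := by
  rw [interpolates_iff_finrank]
  set s := Finset.univ.filter fun i => pairing b i x = r i with hs
  have hmem (u : Fin d → ℝ) :
      u ∈ ⋂ i ∈ s, hyperplane d n b r i ↔ ∀ i, pairing b i x = r i → pairing b i u = r i := by
    simp [hs, hyperplane]
  have hx := (hmem x).2 fun i hi => hi
  rcases hr s with h | h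
  · simp [h] at hx
  · have hspan : Submodule.span ℝ ((fun u => u - x) '' ⋂ i ∈ s, hyperplane d n b r i) =
        commonKer (pairing b) fun i => pairing b i x = r i := by
      refine le_antisymm (Submodule.span_le.2 ?_) fun v hv => Submodule.subset_span ?_
      · rintro _ ⟨u, hu, rfl⟩
        refine mem_commonKer.2 fun i hi => ?_
        simp only [map_sub]
        rw [(hmem u).1 hu i hi, hi, sub_self]
      · refine ⟨x + v, (hmem _).2 fun i hi => ?_, add_sub_cancel_left _ _⟩
        rw [map_add, mem_commonKer.1 hv i hi, add_zero, hi]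
    have := h x hx
    rw [hspan] at this
    rw [this, Module.finrank_fin_fun]

lemma memMatroid_iff_interpolates {F : Finset (Fin n)} :
    memMatroid d n b F ↔ Interpolates (pairing b) (fun i => i ∈ F) := by
  constructor
  · intro h y
    set A : Matrix F (Fin d) ℝ := Matrix.of fun i => toR d (b i.1) with hA
    have hrank : A.rank = Fintype.card F := LinearIndependent.rank_matrix h
    have htop : LinearMap.range A.mulVecLin = ⊤ :=
      Submodule.eq_top_of_finrank_eq (by rw [Module.finrank_fintype_fun_eq_card]; exact hrank)
    obtain ⟨v, hv⟩ := LinearMap.range_eq_top.1 htop fun i => y i.1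
    refine ⟨v, fun i hi => ?_⟩
    have := congrFun hv ⟨i, hi⟩
    simpa [hA, Matrix.mulVec, dotProduct, toR, mul_comm] using this
  · intro h
    rw [memMatroid, Fintype.linearIndependent_iff]
    intro c hc i
    obtain ⟨v, hv⟩ := h fun i => if hi : i ∈ F then c ⟨i, hi⟩ else 0
    have hvc (k : F) : ∑ j, v j * toR d (b k.1) j = c k := by
      simpa [toR] using hv k.1 k.2
    have hsq : ∑ k, c k * c k = 0 := by
      calc ∑ k, c k * c k = ∑ k, c k * ∑ j, v j * toR d (b k.1) j := by simp only [hvc]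
        _ = ∑ j, v j * (∑ k, c k • toR d (b k.1)) j := by
          simp only [Finset.sum_apply, Pi.smul_apply, smul_eq_mul, Finset.mul_sum]
          rw [Finset.sum_comm]
          exact Finset.sum_congr rfl fun j _ => Finset.sum_congr rfl fun k _ => by ring
        _ = 0 := by rw [hc]; simp
    exact mul_self_eq_zero.1 ((Finset.sum_eq_zero_iff_of_nonneg fun k _ =>
      mul_self_nonneg (c k)).1 hsq i (Finset.mem_univ i))

lemma dimF_eq_card {F : Finset (Fin n)} (h : memMatroid d n b F) : dimF d n b F = F.card := by
  have := finrank_span_eq_card h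
  rw [Fintype.card_coe] at this
  rw [← this, dimF, spanF, Set.image_eq_range]
  rfl

lemma sum_fMat_eq_indepPoly :
    (∑ i ∈ Finset.range (d + 1), C (fMat d n b i : ℤ) * X ^ i * (1 - X) ^ (d - i)) =
      indepPoly (pairing b) := by
  have hle (F : Finset (Fin n)) (hF : memMatroid d n b F) : dimF d n b F ≤ d := by
    simpa [dimF] using Submodule.finrank_le (spanF d n b F)
  have hsum := sum_ite_eq_sum_card (memMatroid d n b) (dimF d n b) d hle
    fun i => X ^ i * (1 - X) ^ (d - i)
  simp only [mul_assoc]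
  refine hsum.symm.trans ?_
  let e : Finset (Fin n) ≃ (Fin n → Bool) :=
    { toFun := fun F i => decide (i ∈ F)
      invFun := fun f => Finset.univ.filter fun i => f i = true
      left_inv := fun F => by ext; simp
      right_inv := fun f => by ext; simp }
  rw [indepPoly]
  refine Fintype.sum_equiv e _ _ fun F => ?_
  have he (i : Fin n) : e F i = true ↔ i ∈ F := by simp [e]
  have hcard : trueCount (e F) = F.card := by simp [trueCount, he]
  simp only [he, ← memMatroid_iff_interpolates, hcard, Module.finrank_fin_fun]
  split_ifs with hF
  · rw [dimF_eq_card hF]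
  · rfl

lemma sign_sub_eq_sign_sub_iff {a c ρ : ℝ} : SignType.sign (a - ρ) = SignType.sign (c - ρ) ↔
    (a < ρ ↔ c < ρ) ∧ (a = ρ ↔ c = ρ) := by
  constructor
  · intro h
    rw [← sub_neg, ← sub_neg (a := c), ← sub_eq_zero, ← sub_eq_zero (a := c),
      ← sign_eq_neg_one_iff, ← sign_eq_neg_one_iff (a := c - ρ), ← sign_eq_zero_iff,
      ← sign_eq_zero_iff (a := c - ρ), h]
    exact ⟨Iff.rfl, Iff.rfl⟩
  · rintro ⟨hlt, heq⟩
    rcases lt_trichotomy a ρ with h | h | h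
    · rw [sign_neg (sub_neg.2 h), sign_neg (sub_neg.2 (hlt.1 h))]
    · rw [h, heq.1 h]
    · have hc : ρ < c := lt_of_le_of_ne (not_lt.1 fun hc => h.not_gt (hlt.2 hc))
        fun hc => h.ne' (heq.2 hc.symm)
      rw [sign_pos (sub_pos.2 h), sign_pos (sub_pos.2 hc)]

lemma cellOf_empty (hb : ∀ i, b i ≠ 0) (u : Fin d → ℝ) :
    cellOf d n b r ∅ u =
      signCell (pairing b) r fun i => SignType.sign (pairing b i u - r i) := by
  have hspan (i : Fin n) : toR d (b i) ∉ spanF d n b ∅ := by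
    simp only [spanF, Finset.coe_empty, Set.image_empty, Submodule.span_empty,
      Submodule.mem_bot]
    intro h
    refine hb i (funext fun j => ?_)
    simpa [toR] using congrFun h j
  ext v
  simp [cellOf, flat, signCell, hspan, sign_sub_eq_sign_sub_iff]

lemma fBd_empty_eq_card (hb : ∀ i, b i ≠ 0) (hr : Simple d n b r) (k : ℕ) :
    fBd d n b r ∅ k = Nat.card {σ | BddCell (pairing b) r σ ∧ d - zeroCount σ = k} := by
  have hdim {σ : Fin n → SignType} {x : Fin d → ℝ} (hx : x ∈ signCell (pairing b) r σ) :
      Module.finrank ℝ (vectorSpan ℝ (signCell (pairing b) r σ)) = d - zeroCount σ := by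
    have h1 := interpolates_iff_finrank.1 (interpolates_of_simple hr x)
    rw [Module.finrank_fin_fun] at h1
    rw [vectorSpan_signCell hx, zeroCount_eq hx]
    omega
  have himage : {Cs : Set (Fin d → ℝ) | (∃ u ∈ flat d n b r ∅, Cs = cellOf d n b r ∅ u) ∧
      Bornology.IsBounded Cs ∧ Module.finrank ℝ (vectorSpan ℝ Cs) = k} =
      signCell (pairing b) r '' {σ | BddCell (pairing b) r σ ∧ d - zeroCount σ = k} := by
    ext Cs
    constructor
    · rintro ⟨⟨u, -, rfl⟩, hbd, hk⟩
      rw [cellOf_empty hb] at hbd hk ⊢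
      have hu : u ∈ signCell (pairing b) r fun i => SignType.sign (pairing b i u - r i) :=
        fun i => rfl
      exact ⟨_, ⟨⟨⟨u, hu⟩, (isBounded_signCell_iff hu).1 hbd⟩, (hdim hu).symm.trans hk⟩, rfl⟩
    · rintro ⟨σ, ⟨⟨⟨u, hu⟩, hrec⟩, hk⟩, rfl⟩
      refine ⟨⟨u, by simp [flat], ?_⟩, (isBounded_signCell_iff hu).2 hrec, (hdim hu).trans hk⟩
      rw [cellOf_empty hb]
      exact congrArg _ (funext fun i => (hu i).symm)
  rw [fBd, himage, Nat.card_coe_set_eq, Nat.card_coe_set_eq]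
  exact ((signCell_injOn _ _).mono fun σ hσ => hσ.1).ncard_image

lemma sum_fBd_eq_bddPoly (hb : ∀ i, b i ≠ 0) (hr : Simple d n b r) :
    ∑ i ∈ Finset.range (d + 1), C (fBd d n b r ∅ i : ℤ) * (X - 1) ^ i =
      bddPoly (pairing b) r := by
  simp only [fBd_empty_eq_card hb hr]
  rw [bddPoly, Module.finrank_fin_fun]
  exact (sum_ite_eq_sum_card _ (fun σ => d - zeroCount σ) d (fun _ _ => Nat.sub_le _ _)
    fun i => (X - 1) ^ i).symm

end Configuration

/-- `Σ_i f_i t^i (1-t)^{d-i} = Σ_i f^bd_i (t-1)^i`. -/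
theorem statement7 (d n : ℕ) (hd : 0 < d) (hn : 0 < n)
    (b : Fin n → Fin d → ℤ) (hb : ∀ i, b i ≠ 0)
    (hgen : Submodule.span ℤ (Set.range b) = ⊤)
    (r : Fin n → ℝ) (hr : Simple d n b r) :
    (∑ i ∈ Finset.range (d + 1), C (fMat d n b i : ℤ) * X ^ i * (1 - X) ^ (d - i))
      = ∑ i ∈ Finset.range (d + 1), C (fBd d n b r ∅ i : ℤ) * (X - 1) ^ i := by
  rw [sum_fMat_eq_indepPoly, sum_fBd_eq_bddPoly hb hr]
  exact indepPoly_eq_bddPoly _ _ (eq_zero_of_pairing_eq_zero hgen) (interpolates_of_simple hr)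

end LawrencePaper
end
end

section
/- Suppose the real numbers r_1, …, r_n are chosen so that the hyperplane arrangement H is simple. Then the matroid M_B is coloop free if and only if the complement ℝ^d ∖ (H_1 ∪ ⋯ ∪ H_n) has a bounded connected component. -/
open scoped BigOperators Pointwise
open Polynomial

noncomputable section

namespace LawrencePaper

attribute [local instance] Classical.propDecidable

/-- If `i` is a vector of a coloop-free configuration, it lies in the span of the others. -/
theorem ColoopFree.toR_mem_span {d n : ℕ} {b : Fin n → Fin d → ℤ} (h : ColoopFree d n b)
    (i : Fin n) :
    toR d (b i) ∈ Submodule.span ℝ ((fun j => toR d (b j)) '' {j | j ≠ i}) := by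
  obtain ⟨F, ⟨hF, hmax⟩, hi⟩ := h i
  by_contra hnot
  have hsub : (F : Set (Fin n)) ⊆ {j | j ≠ i} := fun j hj hji => hi (hji ▸ hj)
  have hspan : toR d (b i) ∉ Submodule.span ℝ ((fun j => toR d (b j)) '' (F : Set (Fin n))) :=
    fun h' => hnot (Submodule.span_mono (Set.image_mono hsub) h')
  have hins : LinearIndepOn ℝ (fun j => toR d (b j)) (insert i (F : Set (Fin n))) :=
    (linearIndepOn_insert (by simpa using hi)).2 ⟨hF, hspan⟩
  rw [← Finset.coe_insert] at hins
  have := hmax (insert i F) hins (Finset.subset_insert i F)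
  exact hi (this ▸ Finset.mem_insert_self i F)

/-- If every vector of the configuration lies in the span of the others, the configuration is
coloop free. -/
theorem coloopFree_of_toR_mem_span {d n : ℕ} {b : Fin n → Fin d → ℤ}
    (h : ∀ i, toR d (b i) ∈ Submodule.span ℝ ((fun j => toR d (b j)) '' {j | j ≠ i})) :
    ColoopFree d n b := by
  intro i
  obtain ⟨F, hFsub, -, hFspan, hF⟩ := exists_linearIndepOn_extension
    (K := ℝ) (v := fun j => toR d (b j)) (linearIndepOn_empty ℝ _)
    (Set.empty_subset {j : Fin n | j ≠ i})
  have hall : ∀ j, toR d (b j) ∈ Submodule.span ℝ ((fun j => toR d (b j)) '' F) := by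
    intro j
    by_cases hj : j = i
    · subst hj
      exact Submodule.span_le.2 hFspan (h j)
    · exact hFspan ⟨j, hj, rfl⟩
  refine ⟨F.toFinset, ⟨?_, fun G hG hFG => ?_⟩, fun hi => hFsub (Set.mem_toFinset.1 hi) rfl⟩
  · have hF' : LinearIndepOn ℝ (fun j => toR d (b j)) (F.toFinset : Set (Fin n)) := by
      rwa [Set.coe_toFinset]
    exact hF'
  · refine hFG.antisymm fun k hk => ?_
    by_contra hkF
    have hG' : LinearIndepOn ℝ (fun j => toR d (b j)) (G : Set (Fin n)) := hG
    refine hG'.notMem_span hk (Submodule.span_mono (Set.image_mono ?_) (hall k))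
    intro j hj
    refine ⟨hFG (Set.mem_toFinset.2 hj), ?_⟩
    rintro rfl
    exact hkF (Set.mem_toFinset.2 hj)

/-- Integer vectors generating `ℤ^d` span `ℝ^d`. -/
theorem span_range_toR_eq_top {d n : ℕ} {b : Fin n → Fin d → ℤ}
    (hgen : Submodule.span ℤ (Set.range b) = ⊤) :
    Submodule.span ℝ (Set.range fun i => toR d (b i)) = ⊤ := by
  have key : ∀ z ∈ Submodule.span ℤ (Set.range b),
      toR d z ∈ Submodule.span ℝ (Set.range fun i => toR d (b i)) := by
    intro z hz
    induction hz using Submodule.span_induction with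
    | mem x hx =>
      obtain ⟨i, rfl⟩ := hx
      exact Submodule.subset_span ⟨i, rfl⟩
    | zero =>
      have : toR d 0 = 0 := by ext; simp [toR]
      rw [this]
      exact Submodule.zero_mem _
    | add x y _ _ hx hy =>
      have : toR d (x + y) = toR d x + toR d y := by ext; simp [toR]
      rw [this]
      exact Submodule.add_mem _ hx hy
    | smul a x _ hx =>
      have : toR d (a • x) = (a : ℝ) • toR d x := by ext; simp [toR]
      rw [this]
      exact Submodule.smul_mem _ _ hx
  rw [eq_top_iff, ← (Pi.basisFun ℝ (Fin d)).span_eq, Submodule.span_le]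
  rintro _ ⟨j, rfl⟩
  have : (Pi.basisFun ℝ (Fin d)) j = toR d (Pi.single j 1) := by
    ext k
    by_cases hk : k = j
    · subst hk; simp [toR]
    · simp [toR, hk]
  rw [this]
  exact key _ (hgen ▸ Submodule.mem_top)

/-- A set on which the inner products with a spanning family are bounded is bounded. -/
theorem isBounded_setOf_abs_dotProduct_le {d n : ℕ} {v : Fin n → Fin d → ℝ}
    (hv : Submodule.span ℝ (Set.range v) = ⊤) (C : Fin n → ℝ) :
    Bornology.IsBounded {u : Fin d → ℝ | ∀ i, |u ⬝ᵥ v i| ≤ C i} := by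
  have hc : ∀ j : Fin d, ∃ c : Fin n → ℝ, ∑ i, c i • v i = Pi.single j 1 := fun j =>
    (Submodule.mem_span_range_iff_exists_fun ℝ).1 (hv ▸ Submodule.mem_top)
  choose c hc using hc
  refine isBounded_iff_forall_norm_le.2 ⟨∑ j, ∑ i, |c j i| * |C i|, fun u hu => ?_⟩
  refine (pi_norm_le_iff_of_nonneg (by positivity)).2 fun j => ?_
  have huj : u j = ∑ i, c j i * (u ⬝ᵥ v i) := by
    calc u j = u ⬝ᵥ (Pi.single j 1) := by simp
      _ = ∑ i, c j i * (u ⬝ᵥ v i) := by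
        rw [← hc j, dotProduct_sum]
        simp [dotProduct_smul]
  calc ‖u j‖ ≤ ∑ i, |c j i| * |C i| := by
        rw [Real.norm_eq_abs, huj]
        refine (Finset.abs_sum_le_sum_abs _ _).trans (Finset.sum_le_sum fun i _ => ?_)
        rw [abs_mul]
        exact mul_le_mul_of_nonneg_left ((hu i).trans (le_abs_self _)) (abs_nonneg _)
    _ ≤ ∑ j, ∑ i, |c j i| * |C i| :=
        Finset.single_le_sum (f := fun j => ∑ i, |c j i| * |C i|)
          (fun _ _ => by positivity) (Finset.mem_univ j)

/-- Finitely many nonzero linear forms are simultaneously nonzero at some positive vector. -/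
theorem exists_pos_forall_sum_mul_ne_zero {κ : Type*} [Finite κ] {n : ℕ} (β : κ → Fin n → ℝ)
    (hβ : ∀ k, ∃ i, β k i ≠ 0) :
    ∃ l : Fin n → ℝ, (∀ i, 0 < l i) ∧ ∀ k, ∑ i, l i * β k i ≠ 0 := by
  let P : κ → ℝ[X] := fun k => ∑ i : Fin n, C (β k i) * X ^ (i : ℕ)
  have hP : ∀ k, P k ≠ 0 := by
    intro k hk
    obtain ⟨i, hi⟩ := hβ k
    apply hi
    have := congrArg (fun p => Polynomial.coeff p (i : ℕ)) hk
    simpa [P, Polynomial.finsetSum_coeff, Polynomial.coeff_X_pow, Fin.val_inj] using this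
  have hfin : (⋃ k, {t : ℝ | (P k).IsRoot t}).Finite :=
    Set.finite_iUnion fun k => Polynomial.finite_setOfPred_isRoot (hP k)
  obtain ⟨t, ht, htn⟩ := ((Set.Ioi_infinite (0 : ℝ)).sdiff hfin).nonempty
  refine ⟨fun i => t ^ (i : ℕ), fun i => pow_pos ht _, fun k hk => htn ?_⟩
  refine Set.mem_iUnion.2 ⟨k, ?_⟩
  have : (P k).eval t = ∑ i : Fin n, t ^ (i : ℕ) * β k i := by
    simp only [P, Polynomial.eval_finsetSum, eval_mul, eval_C, eval_pow, eval_X]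
    exact Finset.sum_congr rfl fun i _ => mul_comm _ _
  exact this.trans hk

/-- A basis contained in the configuration yields points with prescribed inner products. -/
theorem exists_dotProduct_eq {d : ℕ} {κ : Type*} (B : Module.Basis κ ℝ (Fin d → ℝ))
    (a : κ → ℝ) : ∃ u : Fin d → ℝ, ∀ k, u ⬝ᵥ B k = a k := by
  refine ⟨(dotProductEquiv ℝ (Fin d)).symm (B.constr ℝ a), fun k => ?_⟩
  rw [← dotProductEquiv_apply_apply, LinearEquiv.apply_symm_apply, B.constr_basis]

/-- Let a basis be chosen among vectors `v i`, each in the span of the others, so that the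
vertex where the basis hyperplanes meet lies on no further hyperplane. Then some region
adjacent to the vertex supports a linear relation with matching signs. -/
theorem exists_relation_of_vertex {d n : ℕ} {v : Fin n → Fin d → ℝ}
    (hcol : ∀ i, v i ∈ Submodule.span ℝ (v '' {j | j ≠ i})) (r : Fin n → ℝ)
    {I : Set (Fin n)} (hI : LinearIndepOn ℝ v I)
    (hspan : ⊤ ≤ Submodule.span ℝ (v '' I))
    (hvert : ∀ p : Fin d → ℝ, (∀ i ∈ I, p ⬝ᵥ v i = r i) → ∀ j ∉ I, p ⬝ᵥ v j ≠ r j) :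
    ∃ (s : Fin n → ℝ) (x : Fin d → ℝ), ∑ k, s k • v k = 0 ∧
      ∀ k, 0 < s k * (x ⬝ᵥ v k - r k) := by
  have hspan' : ⊤ ≤ Submodule.span ℝ (Set.range fun i : I => v i) := by
    rwa [Set.image_eq_range] at hspan
  let B : Module.Basis I ℝ (Fin d → ℝ) := Module.Basis.mk hI hspan'
  have hB : ∀ i : I, B i = v i := fun i => Module.Basis.mk_apply hI hspan' i
  obtain ⟨p, hp⟩ := exists_dotProduct_eq B (fun i => r i)
  simp only [hB] at hp
  have hg := hvert p (fun i hi => hp ⟨i, hi⟩)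
  have hβ : ∀ k : I, ∃ j, (if j ∈ I then 0 else (p ⬝ᵥ v j - r j) * B.repr (v j) k) ≠ 0 := by
    intro k
    by_contra! hk
    have hz : ∀ j : Fin n, j ≠ k → B.coord k (v j) = 0 := by
      intro j hjk
      by_cases hj : j ∈ I
      · have hne : (⟨j, hj⟩ : I) ≠ k := fun h => hjk (congrArg Subtype.val h)
        rw [← hB ⟨j, hj⟩]
        simp [hne]
      · have := hk j
        rw [if_neg hj] at this
        exact (mul_eq_zero.1 this).resolve_left (sub_ne_zero.2 (hg j hj))
    have hle : Submodule.span ℝ (v '' {j | j ≠ (k : Fin n)}) ≤ LinearMap.ker (B.coord k) := by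
      rw [Submodule.span_le]
      rintro _ ⟨j, hj, rfl⟩
      exact hz j hj
    have h0 : B.coord k (v k) = 0 := hle (hcol k)
    rw [← hB k] at h0
    simp at h0
  obtain ⟨l, hl, hne⟩ := exists_pos_forall_sum_mul_ne_zero _ hβ
  set t : Fin n → ℝ := fun j => if j ∈ I then 0 else l j * (p ⬝ᵥ v j - r j) with ht
  set y : Fin d → ℝ := ∑ j, t j • v j with hy
  have hrepr : ∀ k : I, B.repr y k ≠ 0 := by
    intro k
    convert hne k using 1
    rw [hy, map_sum, Finsupp.finsetSum_apply]
    refine Finset.sum_congr rfl fun j _ => ?_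
    by_cases hj : j ∈ I <;> simp [ht, hj, mul_assoc]
  obtain ⟨w, hw⟩ := exists_dotProduct_eq B (fun k => -B.repr y k)
  simp only [hB] at hw
  let s : Fin n → ℝ := fun j =>
    if hj : j ∈ I then -B.repr y ⟨j, hj⟩ else l j * (p ⬝ᵥ v j - r j)
  have hs : ∑ k, s k • v k = 0 := by
    have hbasis : ∑ j, (if hj : j ∈ I then B.repr y ⟨j, hj⟩ else 0) • v j = y := by
      conv_rhs => rw [← B.sum_repr y]
      simp only [hB]
      rw [← Finset.sum_subset (Finset.subset_univ I.toFinset)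
        (fun j _ hj => by rw [dif_neg (by simpa using hj), zero_smul]),
        ← Finset.sum_set_coe]
      exact Finset.sum_congr rfl fun j _ => by simp
    have hst : ∀ k, s k • v k = t k • v k -
        (if hj : k ∈ I then B.repr y ⟨k, hj⟩ else 0) • v k := by
      intro k
      by_cases hk : k ∈ I <;> simp [s, ht, hk]
    rw [Finset.sum_congr rfl fun k _ => hst k, Finset.sum_sub_distrib, hbasis, sub_self]
  have hev : ∀ k, ∀ᶠ ε in nhdsWithin (0 : ℝ) (Set.Ioi 0),
      0 < s k * ((p + ε • w) ⬝ᵥ v k - r k) := by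
    intro k
    by_cases hk : k ∈ I
    · filter_upwards [self_mem_nhdsWithin] with ε hε
      have hpk := hp ⟨k, hk⟩
      have hwk := hw ⟨k, hk⟩
      have hne' := hrepr ⟨k, hk⟩
      simp only at hpk hwk
      rw [add_dotProduct, smul_dotProduct, hpk, hwk]
      simp only [s, dif_pos hk, smul_eq_mul, add_sub_cancel_left]
      have := mul_pos (Set.mem_Ioi.1 hε) (mul_self_pos.2 hne')
      linarith
    · have hcont : Continuous fun ε : ℝ => s k * ((p + ε • w) ⬝ᵥ v k - r k) := by
        simp only [add_dotProduct, smul_dotProduct]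
        fun_prop
      have h0 : 0 < s k * ((p + (0 : ℝ) • w) ⬝ᵥ v k - r k) := by
        simp only [s, dif_neg hk, zero_smul, add_zero]
        rw [mul_assoc]
        exact mul_pos (hl k) (mul_self_pos.2 (sub_ne_zero.2 (hg k hk)))
      exact (hcont.continuousAt.eventually (lt_mem_nhds h0)).filter_mono nhdsWithin_le_nhds
  obtain ⟨ε, hε⟩ := (Filter.eventually_all.2 hev).exists
  exact ⟨s, p + ε • w, hs, hε⟩

/-- A component of the complement whose signs match those of a linear relation is bounded. -/
theorem isBounded_connectedComponentIn_of_relation {d n : ℕ} {b : Fin n → Fin d → ℤ}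
    (hspan : Submodule.span ℝ (Set.range fun i => toR d (b i)) = ⊤)
    (r s : Fin n → ℝ) (x : Fin d → ℝ) (hs : ∑ k, s k • toR d (b k) = 0)
    (hx : ∀ k, 0 < s k * (x ⬝ᵥ toR d (b k) - r k)) :
    Bornology.IsBounded
      (connectedComponentIn (Set.univ \ ⋃ i : Fin n, hyperplane d n b r i) x) := by
  set U := Set.univ \ ⋃ i : Fin n, hyperplane d n b r i with hU
  have hs0 : ∀ k, s k ≠ 0 := fun k h => by simpa [h] using hx k
  have hxU : x ∈ U := by
    refine ⟨trivial, fun h => ?_⟩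
    obtain ⟨i, hi⟩ := Set.mem_iUnion.1 h
    have hi' : x ⬝ᵥ toR d (b i) = r i := hi
    simpa [hi'] using hx i
  have hpos : ∀ u ∈ connectedComponentIn U x, ∀ k, 0 < s k * (u ⬝ᵥ toR d (b k) - r k) := by
    intro u hu k
    by_contra! hle
    have hcont : Continuous fun u : Fin d → ℝ => s k * (u ⬝ᵥ toR d (b k) - r k) := by
      simp only [dotProduct]
      fun_prop
    obtain ⟨z, hz, hz0⟩ := isPreconnected_connectedComponentIn.intermediate_value hu
      (mem_connectedComponentIn hxU) hcont.continuousOn ⟨hle, (hx k).le⟩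
    refine (connectedComponentIn_subset U x hz).2 (Set.mem_iUnion.2 ⟨k, ?_⟩)
    exact sub_eq_zero.1 ((mul_eq_zero.1 hz0).resolve_left (hs0 k))
  set D : ℝ := -∑ k, s k * r k with hD
  refine (isBounded_setOf_abs_dotProduct_le hspan
    (fun k => D / |s k| + |r k|)).subset fun u hu k => ?_
  have hsum : ∑ k, s k * (u ⬝ᵥ toR d (b k) - r k) = D := by
    have h0 : ∑ k, s k * (u ⬝ᵥ toR d (b k)) = 0 := by
      calc ∑ k, s k * (u ⬝ᵥ toR d (b k)) = u ⬝ᵥ ∑ k, s k • toR d (b k) := by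
            rw [dotProduct_sum]
            simp [dotProduct_smul]
        _ = 0 := by rw [hs, dotProduct_zero]
    simp only [mul_sub]
    rw [Finset.sum_sub_distrib, h0, zero_sub]
  have hle : s k * (u ⬝ᵥ toR d (b k) - r k) ≤ D := by
    rw [← hsum]
    exact Finset.single_le_sum (f := fun k => s k * (u ⬝ᵥ toR d (b k) - r k))
      (fun j _ => (hpos u hu j).le) (Finset.mem_univ k)
  have habs : |u ⬝ᵥ toR d (b k) - r k| ≤ D / |s k| := by
    rw [le_div_iff₀ (abs_pos.2 (hs0 k)), mul_comm, ← abs_mul, abs_of_pos (hpos u hu k)]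
    exact hle
  have := abs_add_le (u ⬝ᵥ toR d (b k) - r k) (r k)
  rw [sub_add_cancel] at this
  linarith

/-- If some vector of the configuration is not in the span of the others, all components of
the complement are unbounded. -/
theorem not_isBounded_connectedComponentIn {d n : ℕ} {b : Fin n → Fin d → ℤ} (r : Fin n → ℝ)
    {i : Fin n}
    (hi : toR d (b i) ∉ Submodule.span ℝ ((fun j => toR d (b j)) '' {j | j ≠ i}))
    {x : Fin d → ℝ} (hx : x ∈ Set.univ \ ⋃ i : Fin n, hyperplane d n b r i) :
    ¬ Bornology.IsBounded
      (connectedComponentIn (Set.univ \ ⋃ i : Fin n, hyperplane d n b r i) x) := by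
  obtain ⟨f, hfi, hf⟩ := Submodule.exists_le_ker_of_notMem hi
  have hne : ∀ k, x ⬝ᵥ toR d (b k) - r k ≠ 0 := fun k h =>
    hx.2 (Set.mem_iUnion.2 ⟨k, sub_eq_zero.1 h⟩)
  let w : Fin d → ℝ := ((x ⬝ᵥ toR d (b i) - r i) / f (toR d (b i))) •
    (dotProductEquiv ℝ (Fin d)).symm f
  have hw : ∀ z, w ⬝ᵥ z = (x ⬝ᵥ toR d (b i) - r i) / f (toR d (b i)) * f z := by
    intro z
    rw [smul_dotProduct, ← dotProductEquiv_apply_apply ℝ (Fin d) (LinearEquiv.symm _ _),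
      LinearEquiv.apply_symm_apply, smul_eq_mul]
  have hwi : w ⬝ᵥ toR d (b i) = x ⬝ᵥ toR d (b i) - r i := by
    rw [hw, div_mul_cancel₀ _ hfi]
  have hwj : ∀ j, j ≠ i → w ⬝ᵥ toR d (b j) = 0 := by
    intro j hj
    have : f (toR d (b j)) = 0 := hf (Submodule.subset_span ⟨j, hj, rfl⟩)
    rw [hw, this, mul_zero]
  have hw0 : w ≠ 0 := by
    intro h
    rw [h, zero_dotProduct] at hwi
    exact hne i hwi.symm
  have hray : (fun t : ℝ => x + t • w) '' Set.Ici 0 ⊆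
      connectedComponentIn (Set.univ \ ⋃ i : Fin n, hyperplane d n b r i) x := by
    refine IsPreconnected.subset_connectedComponentIn
      (isPreconnected_Ici.image _ (by fun_prop)) ⟨0, by simp, by simp⟩ ?_
    rintro _ ⟨t, ht, rfl⟩
    refine ⟨trivial, fun h => ?_⟩
    obtain ⟨k, hk⟩ := Set.mem_iUnion.1 h
    have hk' : (x + t • w) ⬝ᵥ toR d (b k) = r k := hk
    rw [add_dotProduct, smul_dotProduct, smul_eq_mul] at hk'
    by_cases hki : k = i
    · subst hki
      rw [hwi] at hk'
      have h1 : (1 + t) * (x ⬝ᵥ toR d (b k) - r k) = 0 := by linarith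
      have ht' : (0 : ℝ) ≤ t := ht
      exact (mul_ne_zero (by positivity) (hne k)) h1
    · rw [hwj k hki, mul_zero, add_zero] at hk'
      exact hne k (sub_eq_zero.2 hk')
  intro hbdd
  obtain ⟨R, hR⟩ := isBounded_iff_forall_norm_le.1 (hbdd.subset hray)
  have hwpos : 0 < ‖w‖ := norm_pos_iff.2 hw0
  have hR0 : 0 ≤ R := (norm_nonneg _).trans (hR _ ⟨0, by simp, rfl⟩)
  have ht : 0 ≤ (R + ‖x‖ + 1) / ‖w‖ := by positivity
  have h1 := hR _ ⟨(R + ‖x‖ + 1) / ‖w‖, ht, rfl⟩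
  have h2 : ‖((R + ‖x‖ + 1) / ‖w‖) • w‖ = R + ‖x‖ + 1 := by
    rw [norm_smul, Real.norm_of_nonneg ht, div_mul_cancel₀ _ hwpos.ne']
  have h3 := norm_sub_le (x + ((R + ‖x‖ + 1) / ‖w‖) • w) x
  rw [add_sub_cancel_left, h2] at h3
  simp only at h1
  linarith

/-- `M_B` is coloop free iff the complement of the arrangement has a
bounded connected component. -/
theorem statement8 (d n : ℕ) (hd : 0 < d) (hn : 0 < n)
    (b : Fin n → Fin d → ℤ) (hb : ∀ i, b i ≠ 0)
    (hgen : Submodule.span ℤ (Set.range b) = ⊤)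
    (r : Fin n → ℝ) (hr : Simple d n b r) :
    ColoopFree d n b ↔
      ∃ x ∈ Set.univ \ ⋃ i : Fin n, hyperplane d n b r i,
        Bornology.IsBounded
          (connectedComponentIn (Set.univ \ ⋃ i : Fin n, hyperplane d n b r i) x) := by
  have hspan := span_range_toR_eq_top hgen
  constructor
  · intro hfree
    obtain ⟨I, -, -, hIspan, hI⟩ := exists_linearIndepOn_extension
      (K := ℝ) (v := fun j => toR d (b j)) (linearIndepOn_empty ℝ _)
      (Set.empty_subset (Set.univ : Set (Fin n)))
    have htop : ⊤ ≤ Submodule.span ℝ ((fun j => toR d (b j)) '' I) := by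
      rw [← hspan, Submodule.span_le, ← Set.image_univ]
      exact hIspan
    have hcard : I.toFinset.card = d := by
      have htop' : ⊤ ≤ Submodule.span ℝ (Set.range fun i : I => toR d (b i)) := by
        rwa [Set.image_eq_range] at htop
      have := Module.finrank_eq_card_basis (Module.Basis.mk hI htop')
      rw [Module.finrank_fin_fun] at this
      rw [Set.toFinset_card, this]
    have hvert : ∀ p : Fin d → ℝ, (∀ i ∈ I, p ⬝ᵥ toR d (b i) = r i) →
        ∀ j ∉ I, p ⬝ᵥ toR d (b j) ≠ r j := by
      intro p hp j hj hpj
      have hmem : p ∈ ⋂ i ∈ insert j I.toFinset, hyperplane d n b r i := by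
        refine Set.mem_iInter₂.2 fun i hi => ?_
        rcases Finset.mem_insert.1 hi with rfl | hi
        · exact hpj
        · exact hp i (Set.mem_toFinset.1 hi)
      rcases hr (insert j I.toFinset) with h | h
      · rw [h] at hmem
        exact hmem
      · have := h p hmem
        rw [Finset.card_insert_of_notMem (by simpa using hj), hcard] at this
        omega
    obtain ⟨s, x, hs, hx⟩ := exists_relation_of_vertex hfree.toR_mem_span r hI htop hvert
    refine ⟨x, ⟨trivial, fun h => ?_⟩,
      isBounded_connectedComponentIn_of_relation hspan r s x hs hx⟩
    obtain ⟨i, hi⟩ := Set.mem_iUnion.1 h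
    have hi' : x ⬝ᵥ toR d (b i) = r i := hi
    simpa [hi'] using hx i
  · rintro ⟨x, hx, hbdd⟩
    refine coloopFree_of_toR_mem_span fun i => ?_
    by_contra hi
    exact not_isBounded_connectedComponentIn r hi hx hbdd

end LawrencePaper
end
end
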